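/- arXiv:1207.6672 — 3 statements merged into one kernel-verified Lean document; each statement's English description precedes it below -/
import Mathlib

section
/- Assume f : ℝ → ℝ is continuous and satisfies (A1): s f(s) > 0 for all s ≠ 0, and (A2): the limits f_0 = lim_{|s|→0} f(s)/φ_p(s) and f_∞ = lim_{|s|→∞} f(s)/φ_p(s) exist and lie in (0, +∞). Suppose for some k, n ∈ ℕ with k ≤ n and ν ∈ {+,−} either λ_n^ν/f_∞ < r < λ_k^ν/f_0 or λ_n^ν/f_0 < r < λ_k^ν/f_∞. Then for each j ∈ {k, k+1, …, n} the problem (φ_p(u'))' + r a(x) f(u) + α(x) φ_p(u⁺) + β(x) φ_p(u⁻) = 0 on (0,1), u(0) = u(1) = 0, has a solution u_j^ν such that u_j^ν has exactly j−1 zeros in (0,1) and ν u_j^ν is positive near 0. -/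
open Set Filter Topology

/-- `φ_p(s) = |s|^{p-2} s`. -/
noncomputable def phip (p s : ℝ) : ℝ := |s| ^ (p - 2) * s

/-- membership in the space `E = {u ∈ C¹[0,1] : u 0 = u 1 = 0}`. -/
def MemE (u : ℝ → ℝ) : Prop := ContDiff ℝ 1 u ∧ u 0 = 0 ∧ u 1 = 0

/-- `u` is nontrivial on `[0,1]`. -/
def Nontriv (u : ℝ → ℝ) : Prop := ∃ x ∈ Set.Icc (0:ℝ) 1, u x ≠ 0

/-- `u ∈ S_k^ν` (ν = 1 or -1): u ∈ E, exactly k-1 interior zeros in (0,1), all zeros of u in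
[0,1] simple, and ν·u positive near 0. -/
def MemS (k : ℕ) (ν : ℝ) (u : ℝ → ℝ) : Prop :=
  MemE u ∧
  {x ∈ Ioo (0:ℝ) 1 | u x = 0}.Finite ∧
  {x ∈ Ioo (0:ℝ) 1 | u x = 0}.ncard = k - 1 ∧
  (∀ x ∈ Icc (0:ℝ) 1, u x = 0 → deriv u x ≠ 0) ∧
  ∃ δ > 0, ∀ x ∈ Ioo (0:ℝ) δ, 0 < ν * u x

/-- the `C¹` norm `‖u‖ = max_{[0,1]} |u| + max_{[0,1]} |u'|` of `E`. -/
noncomputable def normE (u : ℝ → ℝ) : ℝ :=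
  (⨆ x : Icc (0:ℝ) 1, |u x|) + (⨆ x : Icc (0:ℝ) 1, |deriv u x|)

/-- `u` solves `-(φ_p(u'))' = λ a φ_p(u) + α φ_p(u⁺) + β φ_p(u⁻)` on (0,1), u(0)=u(1)=0. -/
def IsHalfSol (p : ℝ) (a α β : ℝ → ℝ) (lam : ℝ) (u : ℝ → ℝ) : Prop :=
  MemE u ∧ ∀ x ∈ Set.Ioo (0:ℝ) 1,
    HasDerivAt (fun y => phip p (deriv u y))
      (-(lam * a x * phip p (u x) + α x * phip p (max (u x) 0)
         + β x * phip p (-min (u x) 0))) x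

/-- `u` solves `(φ_p(u'))' + r a f(u) + α φ_p(u⁺) + β φ_p(u⁻) = 0` on (0,1), u(0)=u(1)=0. -/
def IsSolNod (p r : ℝ) (a α β : ℝ → ℝ) (f : ℝ → ℝ) (u : ℝ → ℝ) : Prop :=
  MemE u ∧ ∀ x ∈ Set.Ioo (0:ℝ) 1,
    HasDerivAt (fun y => phip p (deriv u y))
      (-(r * a x * f (u x) + α x * phip p (max (u x) 0)
         + β x * phip p (-min (u x) 0))) x

section Tonelli

variable {E : Type*} [NormedAddCommGroup E] [NormedSpace ℝ E]

/-- Successive approximations of the delayed equation `y'(t) = F s t (y (t - h))`, `y = y₀` for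
`t ≤ 0`; they become stationary after finitely many steps on each bounded interval. -/
noncomputable def tonelliIter (F : ℝ → ℝ → E → E) (y₀ : E) (h : ℝ) : ℕ → ℝ → ℝ → E
  | 0, _, _ => y₀
  | k + 1, s, x => y₀ + ∫ t in (0 : ℝ)..max x 0, F s t (tonelliIter F y₀ h k s (t - h))

theorem continuous_tonelliIter {F : ℝ → ℝ → E → E}
    (hF : Continuous fun z : ℝ × ℝ × E => F z.1 z.2.1 z.2.2) (y₀ : E) (h : ℝ) (k : ℕ) :
    Continuous fun z : ℝ × ℝ => tonelliIter F y₀ h k z.1 z.2 := by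
  induction k with
  | zero => exact continuous_const
  | succ k ih =>
    have h1 : Continuous (Function.uncurry fun (z : ℝ × ℝ) (t : ℝ) =>
        F z.1 t (tonelliIter F y₀ h k z.1 (t - h))) := by
      have : Continuous fun w : (ℝ × ℝ) × ℝ => tonelliIter F y₀ h k w.1.1 (w.2 - h) :=
        ih.comp (by fun_prop : Continuous fun w : (ℝ × ℝ) × ℝ => (w.1.1, w.2 - h))
      exact hF.comp (by fun_prop : Continuous fun w : (ℝ × ℝ) × ℝ =>
        (w.1.1, w.2, tonelliIter F y₀ h k w.1.1 (w.2 - h)))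
    have h2 := intervalIntegral.continuous_parametric_intervalIntegral_of_continuous (a₀ := 0)
      (μ := MeasureTheory.volume) h1 (by fun_prop : Continuous fun z : ℝ × ℝ => max z.2 0)
    exact continuous_const.add h2

theorem tonelliIter_succ_eq (F : ℝ → ℝ → E → E) (y₀ : E) {h : ℝ} (hh : 0 ≤ h) (k : ℕ) (s : ℝ) :
    ∀ x ≤ k * h, tonelliIter F y₀ h (k + 1) s x = tonelliIter F y₀ h k s x := by
  induction k with
  | zero =>
    intro x hx
    have : max x 0 = 0 := by simpa using hx
    simp [tonelliIter, this]
  | succ k ih =>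
    intro x hx
    rw [tonelliIter, tonelliIter]
    congr 1
    refine intervalIntegral.integral_congr fun t ht => ?_
    rw [uIcc_of_le (le_max_right _ _)] at ht
    have hm : max x 0 ≤ (k + 1 : ℕ) * h := max_le hx (by positivity)
    have : t - h ≤ k * h := by
      have := ht.2.trans hm
      push_cast at this
      linarith
    simp only [ih _ this]

theorem norm_tonelliIter_sub_le {F : ℝ → ℝ → E → E}
    (hF : Continuous fun z : ℝ × ℝ × E => F z.1 z.2.1 z.2.2) {B : ℝ}
    (hB : ∀ s x y, ‖F s x y‖ ≤ B) (y₀ : E) (h : ℝ) (k : ℕ) (s x x' : ℝ) :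
    ‖tonelliIter F y₀ h k s x - tonelliIter F y₀ h k s x'‖ ≤ B * |x - x'| := by
  have hB0 : 0 ≤ B := (norm_nonneg _).trans (hB 0 0 y₀)
  cases k with
  | zero => simp only [tonelliIter, sub_self, norm_zero]; positivity
  | succ k =>
    have hc : Continuous fun t : ℝ => F s t (tonelliIter F y₀ h k s (t - h)) := by
      have : Continuous fun t : ℝ => tonelliIter F y₀ h k s (t - h) :=
        (continuous_tonelliIter hF y₀ h k).comp (by fun_prop : Continuous fun t => (s, t - h))
      exact hF.comp (by fun_prop : Continuous fun t : ℝ =>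
        (s, t, tonelliIter F y₀ h k s (t - h)))
    rw [tonelliIter, tonelliIter, add_sub_add_left_eq_sub,
      intervalIntegral.integral_interval_sub_left (hc.intervalIntegrable _ _)
        (hc.intervalIntegrable _ _)]
    refine (intervalIntegral.norm_integral_le_of_norm_le_const (C := B)
      fun t _ => hB _ _ _).trans ?_
    exact mul_le_mul_of_nonneg_left (abs_max_sub_max_le_abs x x' (0 : ℝ)) hB0

/-- `y` is a continuously differentiable function solving `y' = F x y`, `y 0 = y₀` on `[0,1]`. -/
def SolvesIVP (F : ℝ → E → E) (y₀ : E) (y : ℝ → E) : Prop :=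
  ContDiff ℝ 1 y ∧ y 0 = y₀ ∧ ∀ x ∈ Icc (0 : ℝ) 1, HasDerivAt y (F x (y x)) x

theorem SolvesIVP.of_integral_eq [CompleteSpace E] {F : ℝ → E → E}
    (hF : Continuous fun z : ℝ × E => F z.1 z.2) {y₀ : E} {g : ℝ → E} (hg : Continuous g)
    (h : ∀ x ∈ Icc (0 : ℝ) 1, g x = y₀ + ∫ t in (0 : ℝ)..x, F t (g t)) :
    ∃ y, SolvesIVP F y₀ y ∧ ∀ x ∈ Icc (0 : ℝ) 1, y x = g x := by
  have hc : Continuous fun t => F t (g t) := hF.comp (by fun_prop : Continuous fun t => (t, g t))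
  have hd : ∀ x, HasDerivAt (fun x => y₀ + ∫ t in (0 : ℝ)..x, F t (g t)) (F x (g x)) x :=
    fun x => (hc.integral_hasStrictDerivAt 0 x).hasDerivAt.const_add _
  refine ⟨fun x => y₀ + ∫ t in (0 : ℝ)..x, F t (g t), ⟨?_, by simp, fun x hx => ?_⟩,
    fun x hx => (h x hx).symm⟩
  · rw [contDiff_one_iff_deriv]
    refine ⟨fun x => (hd x).differentiableAt, ?_⟩
    rw [funext fun x => (hd x).deriv]
    exact hc
  · have := hd x
    rwa [h x hx] at this

/-- A sequence of solutions of the delayed equations subconverges to a solution. -/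
theorem exists_solvesIVP_of_delay [ProperSpace E] {F : ℝ → ℝ → E → E}
    (hF : Continuous fun z : ℝ × ℝ × E => F z.1 z.2.1 z.2.2) {B : ℝ}
    (hB : ∀ s x y, ‖F s x y‖ ≤ B) (y₀ : E) {h : ℕ → ℝ} (hh : Tendsto h atTop (𝓝 0))
    {Y : ℕ → ℝ → E} (hY : ∀ n x x', ‖Y n x - Y n x'‖ ≤ B * |x - x'|) {s : ℕ → ℝ}
    (hs : ∀ n, s n ∈ Icc (0 : ℝ) 1)
    (hYs : ∀ n, ∀ x ∈ Icc (0 : ℝ) 1,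
      Y n x = y₀ + ∫ t in (0 : ℝ)..x, F (s n) t (Y n (t - h n))) :
    ∃ s₀ ∈ Icc (0 : ℝ) 1, ∃ y, ∃ φ : ℕ → ℕ, SolvesIVP (F s₀) y₀ y ∧
      Tendsto (fun n => (s (φ n), Y (φ n) 1)) atTop (𝓝 (s₀, y 1)) := by
  have hB0 : 0 ≤ B := (norm_nonneg _).trans (hB 0 0 y₀)
  have hYc : ∀ n, Continuous (Y n) := fun n =>
    (LipschitzWith.of_dist_le_mul (K := ⟨B, hB0⟩) fun x x' => by
      rw [dist_eq_norm, Real.dist_eq]; exact hY n x x').continuous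
  obtain ⟨s₀, hs₀, φ, hφ, hsφ⟩ := isCompact_Icc.tendsto_subseq hs
  let G : ℕ → BoundedContinuousFunction (Icc (0 : ℝ) 1) E := fun n =>
    BoundedContinuousFunction.mkOfCompact ⟨fun x => Y (φ n) x, (hYc _).comp continuous_subtype_val⟩
  have hG : ∀ n x, G n x = Y (φ n) x := fun _ _ => rfl
  have hY0 : ∀ n, Y n 0 = y₀ := fun n => by simpa using hYs n 0 (by simp)
  have hcomp : IsCompact (closure (range G)) := by
    refine BoundedContinuousFunction.arzela_ascoli (Metric.closedBall y₀ B)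
      (isCompact_closedBall _ _) _ ?_ ?_
    · rintro _ x ⟨n, rfl⟩
      rw [hG, Metric.mem_closedBall, dist_eq_norm]
      have h1 := hY (φ n) x 0
      rw [hY0] at h1
      refine h1.trans ?_
      have : |(x : ℝ) - 0| ≤ 1 := by
        rw [sub_zero, abs_of_nonneg x.2.1]; exact x.2.2
      nlinarith
    · refine Metric.equicontinuous_of_continuity_modulus (fun d => B * d) ?_ _ ?_
      · have : Tendsto (fun d : ℝ => B * d) (𝓝 0) (𝓝 (B * 0)) := tendsto_id.const_mul B
        simpa using this
      · rintro x y ⟨_, n, rfl⟩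
        change dist (G n x) (G n y) ≤ B * dist x y
        rw [hG, hG, dist_eq_norm, Subtype.dist_eq, Real.dist_eq]
        exact hY _ _ _
  obtain ⟨g, -, ψ, hψ, hgψ⟩ := hcomp.tendsto_subseq fun n => subset_closure (mem_range_self n)
  have hconv : ∀ x (hx : x ∈ Icc (0 : ℝ) 1),
      Tendsto (fun n => Y (φ (ψ n)) x) atTop (𝓝 (g ⟨x, hx⟩)) := fun x hx =>
    ((continuous_eval_const (F := BoundedContinuousFunction (Icc (0 : ℝ) 1) E)
      (⟨x, hx⟩ : Icc (0 : ℝ) 1)).tendsto g).comp hgψ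
  let y : ℝ → E := fun x => g (projIcc 0 1 zero_le_one x)
  have hy : Continuous y := g.continuous.comp continuous_projIcc
  have hconv' : ∀ x ∈ Icc (0 : ℝ) 1, Tendsto (fun n => Y (φ (ψ n)) x) atTop (𝓝 (y x)) := by
    intro x hx
    have := hconv x hx
    simpa only [y, projIcc_of_mem zero_le_one hx] using this
  have hsψ : Tendsto (fun n => s (φ (ψ n))) atTop (𝓝 s₀) := hsφ.comp hψ.tendsto_atTop
  have hhψ : Tendsto (fun n => h (φ (ψ n))) atTop (𝓝 0) :=
    hh.comp (hφ.tendsto_atTop.comp hψ.tendsto_atTop)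
  have hyint : ∀ x ∈ Icc (0 : ℝ) 1, y x = y₀ + ∫ t in (0 : ℝ)..x, F s₀ t (y t) := by
    intro x hx
    refine tendsto_nhds_unique (hconv' x hx) ?_
    rw [funext fun n => hYs (φ (ψ n)) x hx]
    refine Tendsto.const_add _ ?_
    refine intervalIntegral.tendsto_integral_filter_of_dominated_convergence (fun _ => B)
      (Eventually.of_forall fun n => ?_) (Eventually.of_forall fun n => ?_) (by simp) ?_
    · exact (hF.comp (by have := hYc (φ (ψ n)); fun_prop : Continuous fun t : ℝ =>
        (s (φ (ψ n)), t, Y (φ (ψ n)) (t - h (φ (ψ n)))))).aestronglyMeasurable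
    · exact Eventually.of_forall fun t _ => hB _ _ _
    · refine Eventually.of_forall fun t ht => ?_
      rw [uIoc_of_le hx.1] at ht
      have ht' : t ∈ Icc (0 : ℝ) 1 := ⟨ht.1.le, ht.2.trans hx.2⟩
      have h2 : Tendsto (fun n => Y (φ (ψ n)) (t - h (φ (ψ n))) - Y (φ (ψ n)) t) atTop
          (𝓝 0) := by
        refine squeeze_zero_norm (fun n => hY _ _ _) ?_
        have : Tendsto (fun n => B * |h (φ (ψ n))|) atTop (𝓝 (B * |0|)) :=
          (hhψ.abs).const_mul B
        simpa using this
      have h3 := h2.add (hconv' t ht')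
      simp only [sub_add_cancel, zero_add] at h3
      exact (hF.tendsto (s₀, t, y t)).comp (hsψ.prodMk_nhds (tendsto_const_nhds.prodMk_nhds h3))
  obtain ⟨z, hz, hzy⟩ := SolvesIVP.of_integral_eq
    (hF.comp (by fun_prop : Continuous fun w : ℝ × E => (s₀, w.1, w.2))) hy hyint
  refine ⟨s₀, hs₀, z, fun n => φ (ψ n), hz, hsψ.prodMk_nhds ?_⟩
  rw [hzy 1 (by simp)]
  exact hconv' 1 (by simp)

/-- Shooting without uniqueness: if every solution for the parameter `0` ends on one side of a
level set of `ψ`, and every solution for the parameter `1` ends on the other side, then for an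
intermediate parameter some solution ends on the level set. -/
theorem exists_solvesIVP_eq [ProperSpace E] {F : ℝ → ℝ → E → E}
    (hF : Continuous fun z : ℝ × ℝ × E => F z.1 z.2.1 z.2.2) {B : ℝ}
    (hB : ∀ s x y, ‖F s x y‖ ≤ B) (y₀ : E) {ψ : E → ℝ} (hψ : Continuous ψ) {c : ℝ}
    (h0 : ∀ y, SolvesIVP (F 0) y₀ y → ψ (y 1) < c)
    (h1 : ∀ y, SolvesIVP (F 1) y₀ y → c < ψ (y 1)) :
    ∃ s ∈ Ioo (0 : ℝ) 1, ∃ y, SolvesIVP (F s) y₀ y ∧ ψ (y 1) = c := by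
  let h : ℕ → ℝ := fun n => 1 / ((n : ℝ) + 1)
  have hhpos : ∀ n, 0 ≤ h n := fun n => by positivity
  let Z : ℕ → ℝ → ℝ → E := fun n => tonelliIter F y₀ (h n) (n + 1)
  have hZ : ∀ n s, ∀ x ∈ Icc (0 : ℝ) 1,
      Z n s x = y₀ + ∫ t in (0 : ℝ)..x, F s t (Z n s (t - h n)) := by
    intro n s x hx
    have h2 := tonelliIter_succ_eq F y₀ (hhpos n) (n + 1) s x (by
      have : ((n + 1 : ℕ) : ℝ) * h n = 1 := by
        simp only [h]; push_cast; field_simp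
      rw [this]; exact hx.2)
    simp only [Z]
    rw [← h2, tonelliIter, max_eq_left hx.1]
  have hZc : ∀ n, Continuous fun s => ψ (Z n s 1) := fun n => hψ.comp
    ((continuous_tonelliIter hF y₀ (h n) (n + 1)).comp
      (by fun_prop : Continuous fun s : ℝ => (s, (1 : ℝ))))
  let Q : Set (ℝ × E) := {z | z.1 = 0 ∧ c ≤ ψ z.2} ∪ ({z | z.1 = 1 ∧ ψ z.2 ≤ c} ∪ {z | ψ z.2 = c})
  have hQ : IsClosed Q := by
    refine IsClosed.union ?_ (IsClosed.union ?_ ?_)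
    · exact (isClosed_eq continuous_fst continuous_const).inter
        (isClosed_le continuous_const (hψ.comp continuous_snd))
    · exact (isClosed_eq continuous_fst continuous_const).inter
        (isClosed_le (hψ.comp continuous_snd) continuous_const)
    · exact isClosed_eq (hψ.comp continuous_snd) continuous_const
  have hsel : ∀ n, ∃ s ∈ Icc (0 : ℝ) 1, (s, Z n s 1) ∈ Q := by
    intro n
    by_cases ha : c ≤ ψ (Z n 0 1)
    · exact ⟨0, by simp, Or.inl ⟨rfl, ha⟩⟩
    by_cases hb : ψ (Z n 1 1) ≤ c
    · exact ⟨1, by simp, Or.inr (Or.inl ⟨rfl, hb⟩)⟩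
    push Not at ha hb
    obtain ⟨s, hs, hs'⟩ := intermediate_value_Icc zero_le_one (hZc n).continuousOn ⟨ha.le, hb.le⟩
    exact ⟨s, hs, Or.inr (Or.inr hs')⟩
  choose s hs hsQ using hsel
  obtain ⟨s₀, hs₀, y, φ, hy, hlim⟩ := exists_solvesIVP_of_delay hF hB y₀
    (h := h) tendsto_one_div_add_atTop_nhds_zero_nat (Y := fun n => Z n (s n)) (s := s)
    (fun n x x' => norm_tonelliIter_sub_le hF hB y₀ _ _ _ _ _) hs (fun n => hZ n (s n))
  have hmem : (s₀, y 1) ∈ Q := hQ.mem_of_tendsto hlim (Eventually.of_forall fun n => hsQ _)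
  rcases hmem with ⟨h2, h3⟩ | ⟨h2, h3⟩ | h2
  · simp only at h2 h3
    subst h2
    exact absurd (h0 y hy) (not_lt.2 h3)
  · simp only at h2 h3
    subst h2
    exact absurd (h1 y hy) (not_lt.2 h3)
  · refine ⟨s₀, ⟨lt_of_le_of_ne hs₀.1 ?_, lt_of_le_of_ne hs₀.2 ?_⟩, y, hy, h2⟩
    · rintro rfl
      exact (h0 y hy).ne h2
    · rintro rfl
      exact (h1 y hy).ne' h2

/-- Peano's theorem for a bounded continuous field. -/
theorem exists_solvesIVP [ProperSpace E] {F : ℝ → E → E}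
    (hF : Continuous fun z : ℝ × E => F z.1 z.2) {B : ℝ} (hB : ∀ x y, ‖F x y‖ ≤ B) (y₀ : E) :
    ∃ y, SolvesIVP F y₀ y := by
  by_contra! hno
  obtain ⟨-, -, y, hy, -⟩ := exists_solvesIVP_eq (F := fun _ => F) (c := 0) (ψ := fun _ => 0)
    (hF.comp continuous_snd) (fun _ => hB) y₀ continuous_const
    (fun y hy => absurd hy (hno y)) (fun y hy => absurd hy (hno y))
  exact hno y hy

end Tonelli

section Phip

theorem phip_zero (p : ℝ) : phip p 0 = 0 := by simp [phip]

theorem phip_neg (p s : ℝ) : phip p (-s) = -phip p s := by simp [phip]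

theorem abs_phip {p : ℝ} (hp : 1 < p) (s : ℝ) : |phip p s| = |s| ^ (p - 1) := by
  rcases eq_or_ne s 0 with rfl | hs
  · rw [phip_zero, abs_zero, Real.zero_rpow (by linarith)]
  · have : p - 1 = p - 2 + 1 := by ring
    rw [phip, abs_mul, abs_of_nonneg (by positivity), this, Real.rpow_add_one (abs_ne_zero.2 hs)]

theorem phip_eq_zero {p s : ℝ} : phip p s = 0 ↔ s = 0 := by
  refine ⟨fun h => ?_, fun h => h ▸ phip_zero p⟩
  by_contra hs
  have : 0 < |s| := abs_pos.2 hs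
  exact mul_ne_zero (Real.rpow_pos_of_pos this _).ne' hs h

theorem continuous_phip {p : ℝ} (hp : 1 < p) : Continuous (phip p) := by
  rw [continuous_iff_continuousAt]
  intro s
  rcases eq_or_ne s 0 with rfl | hs
  · rw [ContinuousAt, phip_zero]
    refine squeeze_zero_norm (a := fun s => |s| ^ (p - 1)) (fun s => (abs_phip hp s).le) ?_
    have : Continuous fun s : ℝ => |s| ^ (p - 1) :=
      continuous_abs.rpow_const fun _ => Or.inr (by linarith)
    simpa [Real.zero_rpow (by linarith : p - 1 ≠ 0)] using this.tendsto 0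
  · exact (continuous_abs.continuousAt.rpow_const (Or.inl (abs_ne_zero.2 hs))).mul continuousAt_id

theorem phip_mul {p t : ℝ} (ht : 0 < t) (s : ℝ) : phip p (t * s) = t ^ (p - 1) * phip p s := by
  have : p - 1 = p - 2 + 1 := by ring
  rw [phip, phip, abs_mul, abs_of_pos ht, Real.mul_rpow ht.le (abs_nonneg s), this,
    Real.rpow_add_one ht.ne']
  ring

theorem mul_phip {p : ℝ} (hp : 1 < p) (s : ℝ) : s * phip p s = |s| ^ p := by
  rcases eq_or_ne s 0 with rfl | hs
  · rw [zero_mul, abs_zero, Real.zero_rpow (by linarith)]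
  · have h : p = p - 2 + (2 : ℕ) := by push_cast; ring
    rw [phip]
    conv_rhs => rw [h, Real.rpow_add_natCast (abs_ne_zero.2 hs), sq_abs]
    ring

theorem phip_phip {p q : ℝ} (hpq : p.HolderConjugate q) (s : ℝ) : phip p (phip q s) = s := by
  rcases eq_or_ne s 0 with rfl | hs
  · simp [phip_zero]
  · have h1 : 0 < |s| := abs_pos.2 hs
    have h2 : (q - 1) * (p - 2) + (q - 2) = 0 := by
      have := hpq.sub_one_mul_conj
      have h3 := hpq.mul_eq_add
      nlinarith
    rw [phip, abs_phip hpq.symm.lt, ← Real.rpow_mul h1.le, phip, ← mul_assoc,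
      ← Real.rpow_add h1, h2, Real.rpow_zero, one_mul]

end Phip

section Polar

open Real

/-- The determinant of the polar coordinates `(exp (σ / p) * sin ω, exp (σ / q) * cos ω)`,
up to a positive factor. -/
noncomputable def polarDet (p q ω : ℝ) : ℝ := sin ω ^ 2 / p + cos ω ^ 2 / q

/-- The angular velocity in the coordinates `(exp (σ / p) * sin ω, exp (σ / q) * cos ω)` of a curve
with velocity `(exp (σ / p) * U, exp (σ / q) * V)`. -/
noncomputable def angSpeed (p q U V ω : ℝ) : ℝ :=
  (cos ω / q * U - sin ω / p * V) / polarDet p q ω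

/-- The radial velocity in the coordinates `(exp (σ / p) * sin ω, exp (σ / q) * cos ω)` of a curve
with velocity `(exp (σ / p) * U, exp (σ / q) * V)`. -/
noncomputable def radSpeed (p q U V ω : ℝ) : ℝ :=
  (sin ω * U + cos ω * V) / polarDet p q ω

theorem inv_add_le_polarDet {p q : ℝ} (hp : 0 < p) (hq : 0 < q) (ω : ℝ) :
    (p + q)⁻¹ ≤ polarDet p q ω := by
  have h1 : (p + q)⁻¹ ≤ p⁻¹ := inv_anti₀ hp (by linarith)
  have h2 : (p + q)⁻¹ ≤ q⁻¹ := inv_anti₀ hq (by linarith)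
  have h3 := sin_sq_add_cos_sq ω
  have : polarDet p q ω = sin ω ^ 2 * p⁻¹ + cos ω ^ 2 * q⁻¹ := rfl
  calc (p + q)⁻¹ = sin ω ^ 2 * (p + q)⁻¹ + cos ω ^ 2 * (p + q)⁻¹ := by rw [← add_mul, h3, one_mul]
    _ ≤ _ := by rw [this]; gcongr

theorem polarDet_pos {p q : ℝ} (hp : 0 < p) (hq : 0 < q) (ω : ℝ) : 0 < polarDet p q ω :=
  (inv_pos.2 (by linarith)).trans_le (inv_add_le_polarDet hp hq ω)

theorem continuous_polarDet (p q : ℝ) : Continuous (polarDet p q) := by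
  unfold polarDet; fun_prop

theorem Continuous.angSpeed {X : Type*} [TopologicalSpace X] {p q : ℝ} (hp : 0 < p) (hq : 0 < q)
    {U V ω : X → ℝ} (hU : Continuous U) (hV : Continuous V) (hω : Continuous ω) :
    Continuous fun x => angSpeed p q (U x) (V x) (ω x) := by
  refine Continuous.div (by fun_prop) ((continuous_polarDet p q).comp hω)
    fun x => (polarDet_pos hp hq _).ne'

theorem Continuous.radSpeed {X : Type*} [TopologicalSpace X] {p q : ℝ} (hp : 0 < p) (hq : 0 < q)
    {U V ω : X → ℝ} (hU : Continuous U) (hV : Continuous V) (hω : Continuous ω) :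
    Continuous fun x => radSpeed p q (U x) (V x) (ω x) := by
  refine Continuous.div (by fun_prop) ((continuous_polarDet p q).comp hω)
    fun x => (polarDet_pos hp hq _).ne'

theorem abs_div_polarDet_le {p q : ℝ} (hp : 0 < p) (hq : 0 < q) (x ω : ℝ) :
    |x / polarDet p q ω| ≤ (p + q) * |x| := by
  have hD := polarDet_pos hp hq ω
  rw [abs_div, abs_of_pos hD, div_eq_inv_mul]
  gcongr
  have := inv_anti₀ (inv_pos.2 (by linarith : 0 < p + q)) (inv_add_le_polarDet hp hq ω)
  rwa [inv_inv] at this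

theorem abs_angSpeed_le {p q : ℝ} (hp : 1 < p) (hq : 1 < q) (U V ω : ℝ) :
    |angSpeed p q U V ω| ≤ (p + q) * (|U| + |V|) := by
  refine (abs_div_polarDet_le (by linarith) (by linarith) _ _).trans ?_
  gcongr
  have h1 : |cos ω / q| ≤ 1 := by
    rw [abs_div, abs_of_pos (by linarith : 0 < q)]
    exact div_le_one_of_le₀ ((abs_cos_le_one ω).trans hq.le) (by linarith)
  have h2 : |sin ω / p| ≤ 1 := by
    rw [abs_div, abs_of_pos (by linarith : 0 < p)]
    exact div_le_one_of_le₀ ((abs_sin_le_one ω).trans hp.le) (by linarith)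
  refine (abs_sub _ _).trans ?_
  rw [abs_mul, abs_mul]
  gcongr
  · exact mul_le_of_le_one_left (abs_nonneg _) h1
  · exact mul_le_of_le_one_left (abs_nonneg _) h2

theorem abs_radSpeed_le {p q : ℝ} (hp : 1 < p) (hq : 1 < q) (U V ω : ℝ) :
    |radSpeed p q U V ω| ≤ (p + q) * (|U| + |V|) := by
  refine (abs_div_polarDet_le (by linarith) (by linarith) _ _).trans ?_
  gcongr
  refine (abs_add_le _ _).trans ?_
  rw [abs_mul, abs_mul]
  gcongr
  · exact mul_le_of_le_one_left (abs_nonneg _) (abs_sin_le_one ω)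
  · exact mul_le_of_le_one_left (abs_nonneg _) (abs_cos_le_one ω)

theorem hasDerivAt_polar {p q : ℝ} (hp : 0 < p) (hq : 0 < q) {ω σ : ℝ → ℝ} {U V x : ℝ}
    (hω : HasDerivAt ω (angSpeed p q U V (ω x)) x) (hσ : HasDerivAt σ (radSpeed p q U V (ω x)) x) :
    HasDerivAt (fun y => exp (σ y / p) * sin (ω y)) (exp (σ x / p) * U) x ∧
      HasDerivAt (fun y => exp (σ y / q) * cos (ω y)) (exp (σ x / q) * V) x := by
  have hD := (polarDet_pos hp hq (ω x)).ne'
  constructor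
  · refine ((hσ.div_const p).exp.mul hω.sin).congr_deriv ?_
    rw [mul_assoc, ← mul_add]
    congr 1
    rw [angSpeed, radSpeed]
    field_simp
    rw [polarDet]
    field_simp
    ring
  · refine ((hσ.div_const q).exp.mul hω.cos).congr_deriv ?_
    rw [mul_assoc, ← mul_add]
    congr 1
    rw [angSpeed, radSpeed]
    field_simp
    rw [polarDet]
    field_simp
    ring

theorem angSpeed_of_sin_eq_zero {p q : ℝ} (hq : 1 < q) {ω : ℝ} (hω : sin ω = 0) (V : ℝ) :
    angSpeed p q (phip q (cos ω)) V ω = 1 := by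
  have h1 : cos ω ^ 2 = 1 := by have := sin_sq_add_cos_sq ω; rw [hω] at this; linarith
  have h2 : |cos ω| = 1 := by
    rw [← sq_abs] at h1
    nlinarith [abs_nonneg (cos ω)]
  have h3 : cos ω * phip q (cos ω) = 1 := by rw [mul_phip hq, h2, one_rpow]
  have hq0 : q ≠ 0 := by linarith
  rw [angSpeed, polarDet, hω, h1, div_mul_eq_mul_div, h3]
  simp [hq0]

end Polar

section Angle

open Real

/-- `θ` is differentiable on `[0,1]` and strictly increasing where it is a multiple of `π`. -/
def CrossesUpward (θ : ℝ → ℝ) : Prop :=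
  ∀ x ∈ Icc (0 : ℝ) 1, ∃ d, HasDerivAt θ d x ∧ (sin (θ x) = 0 → 0 < d)

theorem CrossesUpward.continuousOn {θ : ℝ → ℝ} (h : CrossesUpward θ) :
    ContinuousOn θ (Icc 0 1) := fun x hx =>
  (h x hx).choose_spec.1.continuousAt.continuousWithinAt

theorem CrossesUpward.int_mul_pi_lt {θ : ℝ → ℝ} (h : CrossesUpward θ) {x₀ x : ℝ}
    (hx₀ : x₀ ∈ Icc (0 : ℝ) 1) (hx : x ∈ Icc (0 : ℝ) 1) (hlt : x₀ < x) {i : ℤ}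
    (hi : i * π ≤ θ x₀) : i * π < θ x := by
  choose! d hd hpos using h
  have hsub : ∀ {y}, y ∈ Icc x₀ x → y ∈ Icc (0 : ℝ) 1 := fun hy =>
    ⟨hx₀.1.trans hy.1, hy.2.trans hx.2⟩
  have hle : ∀ y ∈ Icc x₀ x, i * π ≤ θ y := by
    intro y hy
    have := image_le_of_deriv_right_lt_deriv_boundary (f := fun y => -θ y) (f' := fun y => -d y)
      (a := x₀) (b := x) (B := fun _ => -(i * π)) (B' := fun _ => 0)
      (fun y hy => (hd y (hsub hy)).neg.continuousAt.continuousWithinAt)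
      (fun y hy => (hd y (hsub (Ico_subset_Icc_self hy))).neg.hasDerivWithinAt)
      (by simpa using hi) (fun y => hasDerivAt_const y _)
      (fun y hy he => by
        have h1 : θ y = i * π := by simpa using he
        have := hpos y (hsub (Ico_subset_Icc_self hy)) (by rw [h1, sin_int_mul_pi])
        linarith) hy
    simpa using this
  refine lt_of_le_of_ne (hle x (right_mem_Icc.2 hlt.le)) fun he => ?_
  have hdx := hpos x hx (by rw [← he, sin_int_mul_pi])
  have h1 := (hasDerivAt_iff_tendsto_slope_left_right.1 (hd x hx)).1
  have h2 : ∀ᶠ y in 𝓝[<] x, 0 < slope θ x y := h1.eventually (lt_mem_nhds hdx)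
  have h3 : ∀ᶠ y in 𝓝[<] x, y ∈ Ioo x₀ x := Ioo_mem_nhdsLT hlt
  obtain ⟨y, hy, hy'⟩ := (h2.and h3).exists
  rw [slope_def_field] at hy
  have h4 := hle y (Ioo_subset_Icc_self hy')
  have h5 : y - x < 0 := by linarith [hy'.2]
  have h6 := (div_pos_iff.1 hy).resolve_left (by rintro ⟨-, h⟩; linarith)
  linarith [h6.1]

theorem CrossesUpward.pos {θ : ℝ → ℝ} (h : CrossesUpward θ) (h0 : θ 0 = 0) {x : ℝ}
    (hx : x ∈ Ioc (0 : ℝ) 1) : 0 < θ x := by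
  have := h.int_mul_pi_lt (i := 0) (by simp) (Ioc_subset_Icc_self hx) hx.1 (by simp [h0])
  simpa using this

theorem CrossesUpward.exists_sin_pos {θ : ℝ → ℝ} (h : CrossesUpward θ) (h0 : θ 0 = 0) :
    ∃ δ > 0, ∀ x ∈ Ioo (0 : ℝ) δ, 0 < sin (θ x) := by
  obtain ⟨d, hd, -⟩ := h 0 (by simp)
  have h1 : ∀ᶠ x in 𝓝 (0 : ℝ), θ x < π :=
    hd.continuousAt.eventually (gt_mem_nhds (by rw [h0]; exact pi_pos))
  obtain ⟨ε, hε, hball⟩ := Metric.eventually_nhds_iff.1 h1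
  refine ⟨min ε 1, by positivity, fun x hx => sin_pos_of_pos_of_lt_pi
    (h.pos h0 ⟨hx.1, hx.2.le.trans (min_le_right _ _)⟩) (hball ?_)⟩
  rw [Real.dist_eq, sub_zero, abs_of_pos hx.1]
  exact hx.2.trans_le (min_le_left _ _)

theorem CrossesUpward.zeros {θ : ℝ → ℝ} (h : CrossesUpward θ) (h0 : θ 0 = 0) {m : ℕ}
    (h1 : θ 1 = m * π) :
    {x ∈ Ioo (0 : ℝ) 1 | sin (θ x) = 0}.Finite ∧
      {x ∈ Ioo (0 : ℝ) 1 | sin (θ x) = 0}.ncard + 1 = m := by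
  set Z := {x ∈ Ioo (0 : ℝ) 1 | sin (θ x) = 0}
  have hm : 0 < m := by
    have := h.pos h0 (x := 1) (by simp)
    rw [h1] at this
    exact_mod_cast pos_of_mul_pos_left this pi_pos.le
  have hmono : ∀ x ∈ Z, ∀ y ∈ Z, x < y → θ x < θ y := by
    rintro x ⟨hx, hx0⟩ y ⟨hy, -⟩ hxy
    obtain ⟨i, hi⟩ := sin_eq_zero_iff.1 hx0
    rw [← hi]
    exact h.int_mul_pi_lt (Ioo_subset_Icc_self hx) (Ioo_subset_Icc_self hy) hxy hi.le
  have hinj : InjOn θ Z := by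
    intro x hx y hy hxy
    rcases lt_trichotomy x y with hl | he | hl
    · exact absurd hxy (hmono x hx y hy hl).ne
    · exact he
    · exact absurd hxy (hmono y hy x hx hl).ne'
  have himage : θ '' Z = (fun i : ℕ => (i : ℝ) * π) '' (Finset.Ioo 0 m : Set ℕ) := by
    ext t
    constructor
    · rintro ⟨x, ⟨hx, hx0⟩, rfl⟩
      obtain ⟨i, hi⟩ := sin_eq_zero_iff.1 hx0
      have h2 := h.pos h0 (Ioo_subset_Ioc_self hx)
      have h3 := h.int_mul_pi_lt (Ioo_subset_Icc_self hx) (by simp) hx.2 hi.le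
      rw [← hi] at h2
      rw [h1] at h3
      have h4 : 0 < i := by exact_mod_cast pos_of_mul_pos_left h2 pi_pos.le
      have h5 : i < m := by exact_mod_cast lt_of_mul_lt_mul_right h3 pi_pos.le
      refine ⟨i.toNat, ?_, ?_⟩
      · simp only [Finset.coe_Ioo, mem_Ioo]; omega
      · have : ((i.toNat : ℤ) : ℝ) = i := by rw [Int.toNat_of_nonneg h4.le]
        rw [Int.cast_natCast] at this
        simp only [this, hi]
    · rintro ⟨i, hi, rfl⟩
      simp only [Finset.coe_Ioo, mem_Ioo] at hi
      have h2 : (0 : ℝ) < i := by exact_mod_cast hi.1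
      have h3 : (i : ℝ) < m := by exact_mod_cast hi.2
      obtain ⟨x, hx, hxi⟩ := intermediate_value_Ioo zero_le_one h.continuousOn
        (show (i : ℝ) * π ∈ Ioo (θ 0) (θ 1) by
          rw [h0, h1]
          exact ⟨by positivity, mul_lt_mul_of_pos_right h3 pi_pos⟩)
      exact ⟨x, ⟨hx, by rw [hxi, sin_nat_mul_pi]⟩, hxi⟩
  have hfin : Z.Finite := Finite.of_finite_image
    (himage ▸ (Finset.finite_toSet _).image _) hinj
  refine ⟨hfin, ?_⟩
  rw [← hinj.ncard_image, himage, ncard_image_of_injective, ncard_coe_finset, Nat.card_Ioo]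
  · omega
  · intro i j hij
    have := mul_right_cancel₀ pi_pos.ne' hij
    exact_mod_cast this

end Angle

section Comparison

open Real

/-- The nonlinearity of the half-quasilinear problem. -/
noncomputable def halfTerm (p lam a α β s : ℝ) : ℝ :=
  lam * a * phip p s + α * phip p (max s 0) + β * phip p (-min s 0)

/-- Bounded Lipschitz functions. -/
def BddLipschitz (g : ℝ → ℝ) : Prop :=
  ∃ K, (∀ x, |g x| ≤ K) ∧ ∀ x y, |g x - g y| ≤ K * |x - y|

theorem BddLipschitz.mul {f g : ℝ → ℝ} (hf : BddLipschitz f) (hg : BddLipschitz g) :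
    BddLipschitz fun x => f x * g x := by
  obtain ⟨K, hK, hK'⟩ := hf
  obtain ⟨L, hL, hL'⟩ := hg
  have hK0 : 0 ≤ K := (abs_nonneg _).trans (hK 0)
  have hL0 : 0 ≤ L := (abs_nonneg _).trans (hL 0)
  refine ⟨K * L + K * L, fun x => ?_, fun x y => ?_⟩
  · rw [abs_mul]
    have := mul_le_mul (hK x) (hL x) (abs_nonneg _) hK0
    nlinarith [mul_nonneg hK0 hL0]
  · have h1 : f x * g x - f y * g y = f x * (g x - g y) + (f x - f y) * g y := by ring
    rw [h1]
    refine (abs_add_le _ _).trans ?_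
    rw [abs_mul, abs_mul]
    have h2 := mul_le_mul (hK x) (hL' x y) (abs_nonneg _) hK0
    have h3 := mul_le_mul (hK' x y) (hL y) (abs_nonneg _) (by positivity)
    linarith

theorem BddLipschitz.neg {f : ℝ → ℝ} (hf : BddLipschitz f) : BddLipschitz fun x => -f x := by
  obtain ⟨K, hK, hK'⟩ := hf
  refine ⟨K, fun x => by simpa using hK x, fun x y => ?_⟩
  rw [neg_sub_neg, abs_sub_comm]
  exact hK' x y

theorem BddLipschitz.abs_rpow {p : ℝ} (hp : 1 < p) {s : ℝ → ℝ} (hs : ∀ x, |s x| ≤ 1)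
    (hs' : ∀ x y, |s x - s y| ≤ |x - y|) : BddLipschitz fun x => |s x| ^ p := by
  refine ⟨p, fun x => ?_, fun x y => ?_⟩
  · rw [abs_of_nonneg (by positivity)]
    exact (rpow_le_one (abs_nonneg _) (hs x) (by linarith)).trans hp.le
  · have h1 := (convex_Icc (-1 : ℝ) 1).norm_image_sub_le_of_norm_hasDerivWithin_le
      (f := fun x : ℝ => |x| ^ p) (C := p)
      (fun x _ => (hasDerivAt_abs_rpow x hp).hasDerivWithinAt) (fun x hx => by
        have h2 : p * |x| ^ (p - 2) * x = p * phip p x := by rw [phip]; ring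
        rw [h2, norm_mul, norm_eq_abs, norm_eq_abs, abs_phip hp, abs_of_pos (by linarith : 0 < p)]
        exact mul_le_of_le_one_right (by linarith)
          (rpow_le_one (abs_nonneg _) (abs_le.2 hx) (by linarith)))
      (abs_le.1 (hs y)) (abs_le.1 (hs x))
    exact h1.trans (mul_le_mul_of_nonneg_left (hs' x y) (by linarith))

theorem bddLipschitz_const_div_polarDet {p q : ℝ} (hp : 1 < p) (hq : 1 < q) (c : ℝ) :
    BddLipschitz fun ω => c / polarDet p q ω := by
  have hp0 : 0 < p := by linarith
  have hq0 : 0 < q := by linarith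
  have hdet : ∀ x y, |polarDet p q y - polarDet p q x| ≤ 2 * (1 / p + 1 / q) * |x - y| := by
    intro x y
    have h1 : polarDet p q y - polarDet p q x =
        (1 / p - 1 / q) * ((sin y - sin x) * (sin y + sin x)) := by
      rw [polarDet, polarDet, cos_sq', cos_sq']; ring
    rw [h1, abs_mul, abs_mul]
    have h2 : |sin y - sin x| ≤ |x - y| := by
      rw [abs_sub_comm x]; exact abs_sin_sub_sin_le _ _
    have h3 : |sin y + sin x| ≤ 2 := (abs_add_le _ _).trans
      (by linarith [abs_sin_le_one x, abs_sin_le_one y])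
    have h4 : |1 / p - 1 / q| ≤ 1 / p + 1 / q := (abs_sub _ _).trans
      (by rw [abs_of_pos (by positivity), abs_of_pos (by positivity)])
    calc _ ≤ (1 / p + 1 / q) * (|x - y| * 2) := by gcongr
      _ = _ := by ring
  set K := 2 * (1 / p + 1 / q)
  refine ⟨(p + q) * |c| + (p + q) * ((p + q) * (|c| * K)), fun x => ?_, fun x y => ?_⟩
  · refine (abs_div_polarDet_le hp0 hq0 _ _).trans (le_add_of_nonneg_right ?_)
    positivity
  · have h1 : c / polarDet p q x - c / polarDet p q y =
        c * (polarDet p q y - polarDet p q x) / polarDet p q x / polarDet p q y := by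
      have h2 := (polarDet_pos hp0 hq0 x).ne'
      have h3 := (polarDet_pos hp0 hq0 y).ne'
      field_simp
    rw [h1]
    have h4 := (abs_div_polarDet_le hp0 hq0
      (c * (polarDet p q y - polarDet p q x) / polarDet p q x) y)
    have h5 := (abs_div_polarDet_le hp0 hq0 (c * (polarDet p q y - polarDet p q x)) x)
    rw [abs_mul] at h5
    calc _ ≤ (p + q) * ((p + q) * (|c| * |polarDet p q y - polarDet p q x|)) :=
          h4.trans (by gcongr)
      _ ≤ (p + q) * ((p + q) * (|c| * (K * |x - y|))) := by gcongr; exact hdet x y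
      _ ≤ ((p + q) * |c| + (p + q) * ((p + q) * (|c| * K))) * |x - y| := by
        have : 0 ≤ (p + q) * |c| * |x - y| := by positivity
        nlinarith

theorem mul_phip_max {p : ℝ} (hp : 1 < p) (s : ℝ) : s * phip p (max s 0) = |max s 0| ^ p := by
  rw [← mul_phip hp]
  rcases le_total s 0 with h | h
  · rw [max_eq_right h, phip_zero, mul_zero, mul_zero]
  · rw [max_eq_left h]

theorem mul_phip_neg_min {p : ℝ} (hp : 1 < p) (s : ℝ) :
    s * phip p (-min s 0) = -|min s 0| ^ p := by
  rw [← mul_phip hp, phip_neg]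
  rcases le_total s 0 with h | h
  · rw [min_eq_left h, mul_neg]
  · rw [min_eq_right h, phip_zero, mul_zero, neg_zero, mul_zero]

/-- The angular velocity of the solutions of the half-quasilinear problem. -/
noncomputable def halfAngSpeed (p q lam a α β ω : ℝ) : ℝ :=
  angSpeed p q (phip q (cos ω)) (-halfTerm p lam a α β (sin ω)) ω

theorem halfAngSpeed_eq {p q : ℝ} (hp : 1 < p) (hq : 1 < q) (lam a α β ω : ℝ) :
    halfAngSpeed p q lam a α β ω = |cos ω| ^ q * (1 / q / polarDet p q ω) +
      lam * a * (|sin ω| ^ p * (1 / p / polarDet p q ω)) +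
      α * (|max (sin ω) 0| ^ p * (1 / p / polarDet p q ω)) +
      β * -(|min (sin ω) 0| ^ p * (1 / p / polarDet p q ω)) := by
  rw [← neg_mul (|min (sin ω) 0| ^ p), ← mul_phip hp, ← mul_phip hq, ← mul_phip_max hp,
    ← mul_phip_neg_min hp, halfAngSpeed, angSpeed, halfTerm]
  ring

theorem exists_halfAngSpeed_lipschitz {p q : ℝ} (hp : 1 < p) (hq : 1 < q) (lam M : ℝ) :
    ∃ L, ∀ a α β, |a| ≤ M → |α| ≤ M → |β| ≤ M → ∀ ω ω',
      |halfAngSpeed p q lam a α β ω - halfAngSpeed p q lam a α β ω'| ≤ L * |ω - ω'| := by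
  have hsin : ∀ x y, |sin x - sin y| ≤ |x - y| := fun x y => abs_sin_sub_sin_le x y
  have hcos : ∀ x y, |cos x - cos y| ≤ |x - y| := fun x y => abs_cos_sub_cos_le x y
  have hP := bddLipschitz_const_div_polarDet hp hq (1 / p)
  obtain ⟨K₀, -, h₀⟩ := (BddLipschitz.abs_rpow hq abs_cos_le_one hcos).mul
    (bddLipschitz_const_div_polarDet hp hq (1 / q))
  obtain ⟨K₁, -, h₁⟩ := (BddLipschitz.abs_rpow hp abs_sin_le_one hsin).mul hP
  obtain ⟨K₂, -, h₂⟩ := (BddLipschitz.abs_rpow hp (s := fun x => max (sin x) 0)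
    (fun x => by
      simpa using (abs_max_sub_max_le_abs (sin x) 0 0).trans (by simpa using abs_sin_le_one x))
    (fun x y => (abs_max_sub_max_le_abs _ _ _).trans (hsin x y))).mul hP
  obtain ⟨K₃, -, h₃⟩ := ((BddLipschitz.abs_rpow hp (s := fun x => min (sin x) 0)
    (fun x => by
      simpa using (abs_min_sub_min_le_max (sin x) 0 0 0).trans (by simpa using abs_sin_le_one x))
    (fun x y => (abs_min_sub_min_le_max _ _ _ _).trans (by simpa using hsin x y))).mul hP).neg
  refine ⟨K₀ + |lam| * M * K₁ + M * K₂ + M * K₃, fun a α β ha hα hβ ω ω' => ?_⟩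
  rw [halfAngSpeed_eq hp hq, halfAngSpeed_eq hp hq]
  have e₀ := h₀ ω ω'
  have e₁ := h₁ ω ω'
  have e₂ := h₂ ω ω'
  have e₃ := h₃ ω ω'
  set d := |ω - ω'|
  have hM : 0 ≤ M := (abs_nonneg _).trans ha
  have key : ∀ c x y K m, |c| ≤ m → |x - y| ≤ K * d → |c * x - c * y| ≤ m * (K * d) := by
    intro c x y K m hc hxy
    rw [← mul_sub, abs_mul]
    exact mul_le_mul hc hxy (abs_nonneg _) ((abs_nonneg _).trans hc)
  have f₁ := key (lam * a) _ _ _ (|lam| * M)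
    (by rw [abs_mul]; exact mul_le_mul_of_nonneg_left ha (abs_nonneg _)) e₁
  have f₂ := key α _ _ _ M hα e₂
  have f₃ := key β _ _ _ M hβ e₃
  have htri : ∀ x₀ x₁ x₂ x₃ y₀ y₁ y₂ y₃ : ℝ, |x₀ + x₁ + x₂ + x₃ - (y₀ + y₁ + y₂ + y₃)| ≤
      |x₀ - y₀| + |x₁ - y₁| + |x₂ - y₂| + |x₃ - y₃| := by
    intro x₀ x₁ x₂ x₃ y₀ y₁ y₂ y₃
    have : x₀ + x₁ + x₂ + x₃ - (y₀ + y₁ + y₂ + y₃) =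
      (x₀ - y₀) + (x₁ - y₁) + (x₂ - y₂) + (x₃ - y₃) := by ring
    rw [this]
    exact (abs_add_le _ _).trans (add_le_add_left (abs_add_three _ _ _) _)
  refine (htri _ _ _ _ _ _ _ _).trans ?_
  linarith

/-- The angle of a solution at the end of the interval is strictly increasing in `lam`. -/
theorem halfAngle_lt {p q : ℝ} (hp : 1 < p) (hq : 1 < q) {a α β : ℝ → ℝ} {M : ℝ}
    (ha : ∀ x ∈ Icc (0 : ℝ) 1, 0 < a x) (haM : ∀ x ∈ Icc (0 : ℝ) 1, |a x| ≤ M)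
    (hα : ∀ x ∈ Icc (0 : ℝ) 1, |α x| ≤ M) (hβ : ∀ x ∈ Icc (0 : ℝ) 1, |β x| ≤ M)
    {lam₁ lam₂ : ℝ} (hlam : lam₁ < lam₂) {ω₁ ω₂ : ℝ → ℝ}
    (h₁ : ∀ x ∈ Icc (0 : ℝ) 1,
      HasDerivAt ω₁ (halfAngSpeed p q lam₁ (a x) (α x) (β x) (ω₁ x)) x)
    (h₂ : ∀ x ∈ Icc (0 : ℝ) 1,
      HasDerivAt ω₂ (halfAngSpeed p q lam₂ (a x) (α x) (β x) (ω₂ x)) x)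
    (h0 : ω₁ 0 = ω₂ 0) : ω₁ 1 < ω₂ 1 := by
  have hp0 : 0 < p := by linarith
  have hq0 : 0 < q := by linarith
  obtain ⟨L, hL⟩ := exists_halfAngSpeed_lipschitz hp hq lam₁ M
  have hL0 : 0 ≤ L := by
    have h := hL (a 0) (α 0) (β 0) (haM 0 (by simp)) (hα 0 (by simp)) (hβ 0 (by simp)) 1 0
    simp only [sub_zero, abs_one, mul_one] at h
    exact (abs_nonneg _).trans h
  let gain : ℝ → ℝ := fun x =>
    (lam₂ - lam₁) * a x * (|sin (ω₂ x)| ^ p * (1 / p / polarDet p q (ω₂ x)))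
  have hgain0 : ∀ x ∈ Icc (0 : ℝ) 1, 0 ≤ gain x := fun x hx => by
    have := ha x hx
    have := polarDet_pos hp0 hq0 (ω₂ x)
    have := sub_pos.2 hlam
    positivity
  have hgain : ∀ x ∈ Icc (0 : ℝ) 1, halfAngSpeed p q lam₁ (a x) (α x) (β x) (ω₁ x) -
      halfAngSpeed p q lam₂ (a x) (α x) (β x) (ω₂ x) ≤ L * |ω₁ x - ω₂ x| - gain x := by
    intro x hx
    have e1 := (abs_le.1 (hL _ _ _ (haM x hx) (hα x hx) (hβ x hx) (ω₁ x) (ω₂ x))).2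
    have e2 : halfAngSpeed p q lam₂ (a x) (α x) (β x) (ω₂ x) =
        halfAngSpeed p q lam₁ (a x) (α x) (β x) (ω₂ x) + gain x := by
      rw [halfAngSpeed_eq hp hq, halfAngSpeed_eq hp hq]
      ring
    linarith
  have hd : ∀ x ∈ Icc (0 : ℝ) 1, HasDerivAt (fun x => ω₁ x - ω₂ x)
      (halfAngSpeed p q lam₁ (a x) (α x) (β x) (ω₁ x) -
        halfAngSpeed p q lam₂ (a x) (α x) (β x) (ω₂ x)) x :=
    fun x hx => (h₁ x hx).sub (h₂ x hx)
  have hweak : ∀ x ∈ Icc (0 : ℝ) 1, ω₁ x - ω₂ x ≤ 0 := by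
    have hε : ∀ ε > 0, ∀ x ∈ Icc (0 : ℝ) 1, ω₁ x - ω₂ x ≤ ε * exp ((L + 1) * x) := by
      intro ε hε
      refine image_le_of_deriv_right_lt_deriv_boundary
        (fun x hx => (hd x hx).continuousAt.continuousWithinAt)
        (fun x hx => (hd x (Ico_subset_Icc_self hx)).hasDerivWithinAt)
        (by simp only [h0, sub_self]; positivity)
        (B' := fun x => ε * (exp ((L + 1) * x) * (L + 1)))
        (fun x => by simpa using (((hasDerivAt_id x).const_mul (L + 1)).exp.const_mul ε)) ?_
      intro x hx he
      have hpos : 0 < ε * exp ((L + 1) * x) := by positivity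
      have e1 := hgain x (Ico_subset_Icc_self hx)
      have e2 := hgain0 x (Ico_subset_Icc_self hx)
      rw [he, abs_of_pos hpos] at e1
      nlinarith
    intro x hx
    refine le_of_forall_pos_le_add fun ε hε' => ?_
    have := hε (ε * (exp ((L + 1) * x))⁻¹) (by positivity) x hx
    rwa [mul_assoc, inv_mul_cancel₀ (exp_pos _).ne', mul_one, ← zero_add ε] at this
  by_contra! hcon
  have hzero : ∀ x ∈ Icc (0 : ℝ) 1, ω₁ x - ω₂ x = 0 := by
    have hg : ∀ x ∈ Icc (0 : ℝ) 1, HasDerivAt (fun x => exp (L * x) * (ω₁ x - ω₂ x)) _ x :=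
      fun x hx => (((hasDerivAt_id x).const_mul L).exp).mul (hd x hx)
    have hanti : AntitoneOn (fun x => exp (L * x) * (ω₁ x - ω₂ x)) (Icc 0 1) := by
      refine antitoneOn_of_hasDerivWithinAt_nonpos (convex_Icc 0 1)
        (fun x hx => (hg x hx).continuousAt.continuousWithinAt)
        (fun x hx => (hg x (interior_subset hx)).hasDerivWithinAt) fun x hx => ?_
      have hx' := interior_subset hx
      have e1 := hgain x hx'
      have e2 := hgain0 x hx'
      rw [abs_of_nonpos (hweak x hx')] at e1
      have e3 := exp_pos (L * x)
      simp only [id, mul_one]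
      nlinarith
    intro x hx
    have e1 := hanti hx (right_mem_Icc.2 zero_le_one) hx.2
    have e2 : 0 ≤ exp (L * 1) * (ω₁ 1 - ω₂ 1) := mul_nonneg (exp_pos _).le (sub_nonneg.2 hcon)
    have e3 := nonneg_of_mul_nonneg_right (e2.trans e1) (exp_pos _)
    exact le_antisymm (hweak x hx) e3
  have hsin : ∀ x ∈ Ioo (0 : ℝ) 1, sin (ω₂ x) = 0 := by
    intro x hx
    have hx' := Ioo_subset_Icc_self hx
    have e0 : (fun x => ω₁ x - ω₂ x) =ᶠ[𝓝 x] fun _ => 0 := by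
      filter_upwards [Ioo_mem_nhds hx.1 hx.2] with y hy using hzero y (Ioo_subset_Icc_self hy)
    have e1 := ((hd x hx').congr_of_eventuallyEq e0.symm).unique (hasDerivAt_const x 0)
    have e2 := hgain x hx'
    rw [e1, hzero x hx', abs_zero, mul_zero] at e2
    have e3 : gain x = 0 := le_antisymm (by linarith) (hgain0 x hx')
    have e4 : 0 < 1 / p / polarDet p q (ω₂ x) := by
      have := polarDet_pos hp0 hq0 (ω₂ x)
      positivity
    have e5 := ha x hx'
    have e6 := sub_pos.2 hlam
    by_contra hne
    have e7 : 0 < |sin (ω₂ x)| := abs_pos.2 hne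
    have : 0 < gain x := by positivity
    exact this.ne' e3
  have hhalf : (1 / 2 : ℝ) ∈ Ioo (0 : ℝ) 1 := by norm_num
  have e0 : (fun x => sin (ω₂ x)) =ᶠ[𝓝 (1 / 2)] fun _ => 0 := by
    filter_upwards [Ioo_mem_nhds hhalf.1 hhalf.2] with y hy using hsin y hy
  have e1 := (((h₂ _ (Ioo_subset_Icc_self hhalf)).sin).congr_of_eventuallyEq e0.symm).unique
    (hasDerivAt_const _ 0)
  rw [halfAngSpeed, angSpeed_of_sin_eq_zero hq (hsin _ hhalf), mul_one] at e1
  have := sin_sq_add_cos_sq (ω₂ (1 / 2))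
  rw [hsin _ hhalf, e1] at this
  norm_num at this

end Comparison

section Lift

open Real

theorem HasDerivAt.comp_fst {y : ℝ → ℝ × ℝ} {y' : ℝ × ℝ} {x : ℝ} (h : HasDerivAt y y' x) :
    HasDerivAt (fun x => (y x).1) y'.1 x :=
  (ContinuousLinearMap.fst ℝ ℝ ℝ).hasFDerivAt.comp_hasDerivAt x h

theorem HasDerivAt.comp_snd {y : ℝ → ℝ × ℝ} {y' : ℝ × ℝ} {x : ℝ} (h : HasDerivAt y y' x) :
    HasDerivAt (fun x => (y x).2) y'.2 x :=
  (ContinuousLinearMap.snd ℝ ℝ ℝ).hasFDerivAt.comp_hasDerivAt x h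

theorem eq_of_hasDerivAt_Ioo {f g d : ℝ → ℝ} {a b : ℝ} (hab : a ≤ b)
    (hf : ContinuousOn f (Icc a b)) (hg : ContinuousOn g (Icc a b))
    (hf' : ∀ x ∈ Ioo a b, HasDerivAt f (d x) x) (hg' : ∀ x ∈ Ioo a b, HasDerivAt g (d x) x)
    (h : f a = g a) : f b = g b := by
  rcases hab.eq_or_lt with rfl | hlt
  · exact h
  obtain ⟨c, -, hc⟩ := exists_hasDerivAt_eq_slope (fun x => f x - g x) (fun x => d x - d x) hlt
    (hf.sub hg) fun x hx => (hf' x hx).sub (hg' x hx)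
  rw [sub_self, h, sub_self, sub_zero, eq_comm, div_eq_zero_iff] at hc
  rcases hc with hc | hc <;> linarith

/-- Polar coordinates along a plane curve avoiding the origin. -/
theorem exists_polar_lift {p q : ℝ} (hp : 1 < p) (hq : 1 < q) {u v U V : ℝ → ℝ}
    (hU : Continuous U) (hV : Continuous V) {B : ℝ} (hUB : ∀ x, |U x| ≤ B) (hVB : ∀ x, |V x| ≤ B)
    (hu : ContinuousOn u (Icc 0 1)) (hv : ContinuousOn v (Icc 0 1))
    (hu' : ∀ x ∈ Ioo (0 : ℝ) 1, HasDerivAt u (U x) x)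
    (hv' : ∀ x ∈ Ioo (0 : ℝ) 1, HasDerivAt v (V x) x)
    (hne : ∀ x ∈ Icc (0 : ℝ) 1, u x = 0 → v x ≠ 0) {ω₀ σ₀ : ℝ}
    (hu0 : u 0 = exp (σ₀ / p) * sin ω₀) (hv0 : v 0 = exp (σ₀ / q) * cos ω₀) :
    ∃ ω σ : ℝ → ℝ, ω 0 = ω₀ ∧ ∀ x ∈ Icc (0 : ℝ) 1,
      u x = exp (σ x / p) * sin (ω x) ∧ v x = exp (σ x / q) * cos (ω x) ∧
      HasDerivAt ω (angSpeed p q (exp (-σ x / p) * U x) (exp (-σ x / q) * V x) (ω x)) x := by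
  have hp0 : 0 < p := by linarith
  have hq0 : 0 < q := by linarith
  obtain ⟨K, hK⟩ := isCompact_Icc.exists_bound_of_continuousOn hu
  obtain ⟨K', hK'⟩ := isCompact_Icc.exists_bound_of_continuousOn hv
  have huv : ContinuousOn (fun x => |u x| + |v x|) (Icc 0 1) := hu.abs.add hv.abs
  obtain ⟨x₀, hx₀, hmin⟩ := isCompact_Icc.exists_isMinOn (nonempty_Icc.2 zero_le_one) huv
  set c := |u x₀| + |v x₀|
  have hc : 0 < c := by
    rcases eq_or_ne (u x₀) 0 with h | h
    · have := abs_pos.2 (hne x₀ hx₀ h)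
      positivity
    · have := abs_pos.2 h
      positivity
  have htop : ∀ {r : ℝ}, 0 < r → Tendsto (fun M : ℝ => exp (M / r)) atTop atTop := fun hr =>
    tendsto_exp_atTop.comp (tendsto_id.atTop_div_const hr)
  have hbot : ∀ {r : ℝ}, 0 < r → Tendsto (fun M : ℝ => exp (-M / r)) atTop (𝓝 0) := fun hr =>
    tendsto_exp_atBot.comp ((tendsto_neg_atTop_atBot).atBot_div_const hr)
  obtain ⟨M, hM1, hM2, hM3, hM4, hM0⟩ := (((htop hp0).eventually (eventually_gt_atTop (2 * K))).and
    (((htop hq0).eventually (eventually_gt_atTop (2 * K'))).and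
    (((hbot hp0).eventually (gt_mem_nhds (half_pos hc))).and
    (((hbot hq0).eventually (gt_mem_nhds (half_pos hc))).and
    (eventually_ge_atTop 0))))).exists
  let cl : ℝ → ℝ := fun s => max (-M) (min M s)
  have hcl : Continuous cl := by fun_prop
  have hclM : ∀ s, -M ≤ cl s := fun s => le_max_left _ _
  have hcl_eq : ∀ s, |s| < M → cl s = s := fun s hs => by
    rw [abs_lt] at hs
    simp only [cl]
    rw [min_eq_right hs.2.le, max_eq_right hs.1.le]
  let F : ℝ → ℝ × ℝ → ℝ × ℝ := fun x y =>
    (angSpeed p q (exp (-cl y.2 / p) * U x) (exp (-cl y.2 / q) * V x) y.1,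
      radSpeed p q (exp (-cl y.2 / p) * U x) (exp (-cl y.2 / q) * V x) y.1)
  have hF : Continuous fun z : ℝ × ℝ × ℝ => F z.1 z.2 :=
    (Continuous.angSpeed hp0 hq0 (by fun_prop) (by fun_prop) (by fun_prop)).prodMk
      (Continuous.radSpeed hp0 hq0 (by fun_prop) (by fun_prop) (by fun_prop))
  have hexp : ∀ {r W : ℝ} (s : ℝ), 0 < r → |W| ≤ B → |exp (-cl s / r) * W| ≤ exp (M / r) * B := by
    intro r W s hr hW
    rw [abs_mul, abs_of_pos (exp_pos _)]
    gcongr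
    linarith [hclM s]
  have hFB : ∀ x y, ‖F x y‖ ≤ (p + q) * (exp (M / p) * B + exp (M / q) * B) := by
    intro x y
    have h1 := hexp y.2 hp0 (hUB x)
    have h2 := hexp y.2 hq0 (hVB x)
    refine norm_prod_le_iff.2 ⟨?_, ?_⟩
    · exact (abs_angSpeed_le hp hq _ _ _).trans (by gcongr)
    · exact (abs_radSpeed_le hp hq _ _ _).trans (by gcongr)
  obtain ⟨y, hyc, hy0, hy⟩ := exists_solvesIVP hF hFB (ω₀, σ₀)
  have hid : ∀ x ∈ Icc (0 : ℝ) 1, (∀ t ∈ Ico (0 : ℝ) x, |(y t).2| < M) →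
      u x = exp ((y x).2 / p) * sin (y x).1 ∧ v x = exp ((y x).2 / q) * cos (y x).1 := by
    intro x hx hlt
    have hcont := hyc.continuous
    have hpol : ∀ t ∈ Ioo (0 : ℝ) x, HasDerivAt (fun x => exp ((y x).2 / p) * sin (y x).1) (U t) t ∧
        HasDerivAt (fun x => exp ((y x).2 / q) * cos (y x).1) (V t) t := by
      intro t ht
      have hd := hy t ⟨ht.1.le, ht.2.le.trans hx.2⟩
      have hpol := hasDerivAt_polar hp0 hq0 hd.comp_fst hd.comp_snd
      rw [hcl_eq _ (hlt t (Ioo_subset_Ico_self ht))] at hpol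
      have h1 : ∀ r W : ℝ, exp ((y t).2 / r) * (exp (-(y t).2 / r) * W) = W := by
        intro r W
        rw [← mul_assoc, ← exp_add, neg_div, add_neg_cancel, exp_zero, one_mul]
      rwa [h1, h1] at hpol
    have hsub : Icc 0 x ⊆ Icc (0 : ℝ) 1 := Icc_subset_Icc_right hx.2
    have hsub' : ∀ {t}, t ∈ Ioo 0 x → t ∈ Ioo (0 : ℝ) 1 := fun ht => ⟨ht.1, ht.2.trans_le hx.2⟩
    exact ⟨eq_of_hasDerivAt_Ioo hx.1 (hu.mono hsub)
        (Continuous.continuousOn (by fun_prop)) (fun t ht => hu' t (hsub' ht))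
        (fun t ht => (hpol t ht).1) (by rw [hu0, hy0]),
      eq_of_hasDerivAt_Ioo hx.1 (hv.mono hsub)
        (Continuous.continuousOn (by fun_prop)) (fun t ht => hv' t (hsub' ht))
        (fun t ht => (hpol t ht).2) (by rw [hv0, hy0])⟩
  have hlt : ∀ x ∈ Icc (0 : ℝ) 1, |(y x).2| < M := by
    by_contra! hcon
    have hclosed : IsClosed {x | M ≤ |(y x).2|} :=
      isClosed_le continuous_const (continuous_snd.comp hyc.continuous).abs
    obtain ⟨x, ⟨hx, hxM⟩, hleast⟩ := (isCompact_Icc.inter_right hclosed).exists_isLeast hcon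
    obtain ⟨h1, h2⟩ := hid x hx fun t ht => by
      by_contra! h
      exact absurd (hleast ⟨⟨ht.1, ht.2.le.trans hx.2⟩, h⟩) (not_le.2 ht.2)
    have h3 := hK x hx
    have h4 := hK' x hx
    have h5 : c ≤ |u x| + |v x| := hmin hx
    rw [norm_eq_abs, h1, abs_mul, abs_of_pos (exp_pos _)] at h3
    rw [norm_eq_abs, h2, abs_mul, abs_of_pos (exp_pos _)] at h4
    rw [h1, h2, abs_mul, abs_mul, abs_of_pos (exp_pos _), abs_of_pos (exp_pos _)] at h5
    have hxM' : M ≤ |(y x).2| := hxM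
    rcases le_abs.1 hxM' with h | h
    · have e1 : exp (M / p) ≤ exp ((y x).2 / p) := by gcongr
      have e2 : exp (M / q) ≤ exp ((y x).2 / q) := by gcongr
      have e3 : |sin (y x).1| < 1 / 2 := by
        by_contra! h6
        nlinarith [exp_pos (M / p)]
      have e4 : |cos (y x).1| < 1 / 2 := by
        by_contra! h6
        nlinarith [exp_pos (M / q)]
      have e5 := sin_sq_add_cos_sq (y x).1
      rw [← sq_abs, ← sq_abs (cos _)] at e5
      nlinarith [abs_nonneg (sin (y x).1), abs_nonneg (cos (y x).1)]
    · have e1 : exp ((y x).2 / p) ≤ exp (-M / p) := by gcongr; linarith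
      have e2 : exp ((y x).2 / q) ≤ exp (-M / q) := by gcongr; linarith
      have e3 := mul_le_of_le_one_right (exp_pos ((y x).2 / p)).le (abs_sin_le_one (y x).1)
      have e4 := mul_le_of_le_one_right (exp_pos ((y x).2 / q)).le (abs_cos_le_one (y x).1)
      linarith
  refine ⟨fun x => (y x).1, fun x => (y x).2, by simp only [hy0], fun x hx => ?_⟩
  obtain ⟨h1, h2⟩ := hid x hx fun t ht => hlt t ⟨ht.1, ht.2.le.trans hx.2⟩
  refine ⟨h1, h2, ?_⟩
  have := (hy x hx).comp_fst
  simpa only [F, hcl_eq _ (hlt x hx)] using this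

end Lift

section HalfAngle

open Real

theorem sin_sub_of_sin_eq_zero {ω₀ : ℝ} (h₀ : sin ω₀ = 0) (ω : ℝ) :
    sin (ω - ω₀) = cos ω₀ * sin ω := by
  rw [sin_sub, h₀, mul_zero, sub_zero, mul_comm]

theorem crossesUpward_sub {p q : ℝ} (hq : 1 < q) {ω : ℝ → ℝ} {ω₀ : ℝ} (h₀ : sin ω₀ = 0)
    (h : ∀ x ∈ Icc (0 : ℝ) 1, ∃ V, HasDerivAt ω (angSpeed p q (phip q (cos (ω x))) V (ω x)) x) :
    CrossesUpward fun x => ω x - ω₀ := by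
  intro x hx
  obtain ⟨V, hV⟩ := h x hx
  refine ⟨_, hV.sub_const ω₀, fun hs => ?_⟩
  have hc : cos ω₀ ≠ 0 := fun hc => by simpa [h₀, hc] using sin_sq_add_cos_sq ω₀
  rw [sin_sub_of_sin_eq_zero h₀, mul_eq_zero, or_iff_right hc] at hs
  rw [angSpeed_of_sin_eq_zero hq hs]
  exact one_pos

theorem halfTerm_mul {p t : ℝ} (ht : 0 < t) (lam a α β s : ℝ) :
    halfTerm p lam a α β (t * s) = t ^ (p - 1) * halfTerm p lam a α β s := by
  have h1 : max (t * s) 0 = t * max s 0 := by rw [mul_max_of_nonneg _ _ ht.le, mul_zero]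
  have h2 : -min (t * s) 0 = t * -min s 0 := by
    rw [mul_neg, mul_min_of_nonneg _ _ ht.le, mul_zero]
  rw [halfTerm, halfTerm, h1, h2, phip_mul ht, phip_mul ht, phip_mul ht]
  ring

theorem exp_div_rpow {p q : ℝ} (hpq : p.HolderConjugate q) (s : ℝ) :
    exp (s / p) ^ (p - 1) = exp (s / q) := by
  rw [← exp_mul]
  congr 1
  have := hpq.pos.ne'
  have := hpq.symm.pos.ne'
  field_simp
  linear_combination s * hpq.sub_one_mul_conj

theorem exists_continuous_bounded_extension {g : ℝ → ℝ} (hg : ContinuousOn g (Icc 0 1)) :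
    ∃ G : ℝ → ℝ, Continuous G ∧ EqOn G g (Icc 0 1) ∧ ∃ B, ∀ x, |G x| ≤ B := by
  obtain ⟨B, hB⟩ := isCompact_Icc.exists_bound_of_continuousOn hg
  refine ⟨IccExtend (zero_le_one' ℝ) ((Icc 0 1).domRestrict g),
    (continuousOn_iff_continuous_domRestrict.1 hg).Icc_extend', fun x hx => ?_, B, fun x => ?_⟩
  · exact IccExtend_of_mem _ _ hx
  · exact hB _ (projIcc (0 : ℝ) 1 zero_le_one x).2

theorem ContinuousOn.halfTerm {p : ℝ} (hp : 1 < p) {a α β u : ℝ → ℝ} {s : Set ℝ} (lam : ℝ)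
    (ha : ContinuousOn a s) (hα : ContinuousOn α s) (hβ : ContinuousOn β s)
    (hu : ContinuousOn u s) :
    ContinuousOn (fun x => halfTerm p lam (a x) (α x) (β x) (u x)) s := by
  have h := continuous_phip hp
  have h1 : ContinuousOn (fun x => phip p (u x)) s := h.comp_continuousOn hu
  have h2 : ContinuousOn (fun x => phip p (max (u x) 0)) s :=
    h.comp_continuousOn (hu.sup continuousOn_const)
  have h3 : ContinuousOn (fun x => phip p (-min (u x) 0)) s :=
    h.comp_continuousOn (hu.inf continuousOn_const).neg
  exact (((continuousOn_const.mul ha).mul h1).add (hα.mul h2)).add (hβ.mul h3)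

theorem deriv_pos_of_pos_near {u : ℝ → ℝ} {ν : ℝ} (hu : DifferentiableAt ℝ u 0) (hu0 : u 0 = 0)
    (h : ∃ δ > 0, ∀ x ∈ Ioo (0 : ℝ) δ, 0 < ν * u x) (hν : ν ≠ 0) (hd : deriv u 0 ≠ 0) :
    0 < ν * deriv u 0 := by
  obtain ⟨δ, hδ, h⟩ := h
  refine lt_of_le_of_ne ?_ (mul_ne_zero hν hd).symm
  have h1 := (hasDerivWithinAt_iff_tendsto_slope' self_notMem_Ioi).1
    (hu.hasDerivAt.const_mul ν).hasDerivWithinAt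
  refine ge_of_tendsto h1 ?_
  filter_upwards [Ioo_mem_nhdsGT hδ] with x hx
  rw [slope_def_field, hu0, mul_zero, sub_zero, sub_zero]
  exact (div_pos (h x hx) hx.1).le

/-- The angle of a nodal solution of the half-quasilinear problem. -/
theorem exists_halfAngle {p q : ℝ} (hpq : p.HolderConjugate q) {a α β : ℝ → ℝ}
    (ha : ContinuousOn a (Icc 0 1)) (hα : ContinuousOn α (Icc 0 1))
    (hβ : ContinuousOn β (Icc 0 1)) {lam : ℝ} {u : ℝ → ℝ} (hu : IsHalfSol p a α β lam u) {j : ℕ}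
    (hj : 1 ≤ j) {ν : ℝ} (hS : MemS j ν u) {ω₀ : ℝ} (hsin : sin ω₀ = 0) (hcos : cos ω₀ = ν) :
    ∃ ω : ℝ → ℝ, ω 0 = ω₀ ∧ ω 1 = ω₀ + j * π ∧
      ∀ x ∈ Icc (0 : ℝ) 1, HasDerivAt ω (halfAngSpeed p q lam (a x) (α x) (β x) (ω x)) x := by
  have hp := hpq.lt
  have hq := hpq.symm.lt
  obtain ⟨⟨hu1, hu0, hu01⟩, hode⟩ := hu
  obtain ⟨-, hfin, hcard, hsimple, hpos⟩ := hS
  have hν2 : ν ^ 2 = 1 := by rw [← hcos]; have := sin_sq_add_cos_sq ω₀; simp_all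
  have hν : ν ≠ 0 := by rintro rfl; norm_num at hν2
  have hudiff : Differentiable ℝ u := hu1.differentiable one_ne_zero
  have hd0 : 0 < ν * deriv u 0 := deriv_pos_of_pos_near (hudiff 0) hu0 hpos hν
    (hsimple 0 (left_mem_Icc.2 zero_le_one) hu0)
  have hdc : Continuous (deriv u) := hu1.continuous_deriv le_rfl
  have hvc : Continuous fun x => phip p (deriv u x) := (continuous_phip hp).comp hdc
  obtain ⟨U, hUc, hU, B₁, hB₁⟩ := exists_continuous_bounded_extension hdc.continuousOn
  obtain ⟨V, hVc, hV, B₂, hB₂⟩ := exists_continuous_bounded_extension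
    (ContinuousOn.halfTerm hp lam ha hα hβ hu1.continuous.continuousOn).neg
  have hv0 : 0 < ν * phip p (deriv u 0) := by
    have h := mul_phip hp (deriv u 0)
    have h1 : 0 < deriv u 0 * phip p (deriv u 0) := by
      rw [h]; exact rpow_pos_of_pos (abs_pos.2 (right_ne_zero_of_mul hd0.ne')) _
    nlinarith [mul_pos hd0 h1]
  obtain ⟨ω, σ, hω0, hpol⟩ := exists_polar_lift hp hq hUc hVc
    (B := max B₁ B₂) (fun x => (hB₁ x).trans (le_max_left _ _))
    (fun x => (hB₂ x).trans (le_max_right _ _)) hudiff.continuous.continuousOn hvc.continuousOn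
    (fun x hx => by rw [hU (Ioo_subset_Icc_self hx)]; exact (hudiff x).hasDerivAt)
    (fun x hx => by
      rw [hV (Ioo_subset_Icc_self hx)]
      exact hode x hx)
    (fun x hx h => mt phip_eq_zero.1 (hsimple x hx h)) (ω₀ := ω₀)
    (σ₀ := q * log (ν * phip p (deriv u 0))) (by rw [hsin, hu0, mul_zero])
    (by
      rw [mul_div_cancel_left₀ _ hpq.symm.pos.ne', exp_log hv0, hcos]
      linear_combination -(phip p (deriv u 0)) * hν2)
  have hder : ∀ x ∈ Icc (0 : ℝ) 1,
      HasDerivAt ω (halfAngSpeed p q lam (a x) (α x) (β x) (ω x)) x := by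
    intro x hx
    obtain ⟨h1, h2, h3⟩ := hpol x hx
    have e1 : exp (-σ x / p) * U x = phip q (cos (ω x)) := by
      have e : cos (ω x) = exp (-σ x / q) * phip p (deriv u x) := by
        rw [h2, ← mul_assoc, ← exp_add, neg_div, neg_add_cancel, exp_zero, one_mul]
      rw [hU hx, e, phip_mul (exp_pos _), exp_div_rpow hpq.symm, phip_phip hpq.symm]
    have e2 : exp (-σ x / q) * V x = -halfTerm p lam (a x) (α x) (β x) (sin (ω x)) := by
      have e : sin (ω x) = exp (-σ x / p) * u x := by
        rw [h1, ← mul_assoc, ← exp_add, neg_div, neg_add_cancel, exp_zero, one_mul]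
      rw [hV hx, e, halfTerm_mul (exp_pos _), exp_div_rpow hpq]
      simp only [Pi.neg_apply, mul_neg]
    rwa [e1, e2] at h3
  refine ⟨ω, hω0, ?_, hder⟩
  have hcross : CrossesUpward fun x => ω x - ω₀ :=
    crossesUpward_sub (p := p) hq hsin fun x hx => ⟨_, hder x hx⟩
  have hzero : ∀ x ∈ Icc (0 : ℝ) 1, sin (ω x - ω₀) = 0 ↔ u x = 0 := by
    intro x hx
    rw [sin_sub_of_sin_eq_zero hsin, hcos, (hpol x hx).1]
    simp [hν, (exp_pos _).ne']
  have h1 : (1 : ℝ) ∈ Icc (0 : ℝ) 1 := right_mem_Icc.2 zero_le_one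
  obtain ⟨m, hm⟩ := sin_eq_zero_iff.1 ((hzero 1 h1).2 hu01)
  have hmpos : 0 < m := by
    have := hcross.pos (by simp [hω0]) (right_mem_Ioc.2 zero_lt_one)
    rw [← hm] at this
    exact_mod_cast pos_of_mul_pos_left this pi_pos.le
  lift m to ℕ using hmpos.le
  have hz := (hcross.zeros (by simp [hω0]) (m := m) (by rw [← hm]; norm_cast)).2
  have hset : {x ∈ Ioo (0 : ℝ) 1 | sin (ω x - ω₀) = 0} = {x ∈ Ioo (0 : ℝ) 1 | u x = 0} := by
    ext x
    exact and_congr_right fun hx => hzero x (Ioo_subset_Icc_self hx)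
  simp only [hset, hcard] at hz
  have hmj : m = j := by omega
  rw [hmj] at hm
  push_cast at hm
  linarith

end HalfAngle

section Interpolation

open Real

/-- The ratio `f / φ_p`, with value `f0` at the origin. -/
noncomputable def phipRatio (p f0 : ℝ) (f : ℝ → ℝ) : ℝ → ℝ :=
  Function.update (fun s => f s / phip p s) 0 f0

theorem phipRatio_zero (p f0 : ℝ) (f : ℝ → ℝ) : phipRatio p f0 f 0 = f0 :=
  Function.update_self ..

theorem phipRatio_of_ne (p f0 : ℝ) (f : ℝ → ℝ) {s : ℝ} (hs : s ≠ 0) :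
    phipRatio p f0 f s = f s / phip p s :=
  Function.update_of_ne hs ..

theorem phipRatio_mul_phip {p f0 : ℝ} {f : ℝ → ℝ} (hf : f 0 = 0) (s : ℝ) :
    phipRatio p f0 f s * phip p s = f s := by
  rcases eq_or_ne s 0 with rfl | hs
  · rw [phip_zero, mul_zero, hf]
  · rw [phipRatio_of_ne p f0 f hs, div_mul_cancel₀ _ (mt phip_eq_zero.1 hs)]

theorem continuous_phipRatio {p f0 : ℝ} (hp : 1 < p) {f : ℝ → ℝ} (hf : Continuous f)
    (hf0 : Tendsto (fun s => f s / phip p s) (𝓝[≠] 0) (𝓝 f0)) : Continuous (phipRatio p f0 f) := by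
  rw [continuous_iff_continuousAt]
  intro s
  rcases eq_or_ne s 0 with rfl | hs
  · exact continuousAt_update_same.2 hf0
  · refine (continuousAt_update_of_ne hs).2 ?_
    exact hf.continuousAt.div (continuous_phip hp).continuousAt (mt phip_eq_zero.1 hs)

theorem tendsto_phipRatio {p f0 finf : ℝ} {f : ℝ → ℝ}
    (hfinf : Tendsto (fun s => f s / phip p s) (atBot ⊔ atTop) (𝓝 finf)) :
    Tendsto (phipRatio p f0 f) (Bornology.cobounded ℝ) (𝓝 finf) := by
  rw [← IsOrderBornology.cobounded_eq] at hfinf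
  refine hfinf.congr' ?_
  filter_upwards [Bornology.eventually_ne_cobounded (0 : ℝ)] with s hs
  rw [phipRatio_of_ne p f0 f hs]

theorem exists_abs_le_of_tendsto_cobounded {h : ℝ → ℝ} {l : ℝ} (hc : Continuous h)
    (hl : Tendsto h (Bornology.cobounded ℝ) (𝓝 l)) : ∃ B, 0 ≤ B ∧ |l| ≤ B ∧ ∀ s, |h s| ≤ B := by
  have h1 := hl.abs.eventually (gt_mem_nhds (lt_add_one |l|))
  obtain ⟨R, -, hR⟩ := (hasBasis_cobounded_norm (E := ℝ)).eventually_iff.1 h1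
  obtain ⟨K, hK⟩ := (isCompact_closedBall (0 : ℝ) R).exists_bound_of_continuousOn hc.continuousOn
  refine ⟨max (|l| + 1) K, ?_, ?_, fun s => ?_⟩
  · exact le_max_of_le_left (by positivity)
  · exact le_max_of_le_left (by linarith)
  rcases le_total R ‖s‖ with hs | hs
  · exact le_max_of_le_left (hR hs).le
  · exact le_max_of_le_right (hK s (mem_closedBall_zero_iff.2 hs))

/-- The function `h (w / d)`, extended by `l` to `d = 0`. -/
noncomputable def ratioInterp (h : ℝ → ℝ) (l d w : ℝ) : ℝ :=
  if d = 0 then l else h (w / d)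

theorem abs_ratioInterp_le {h : ℝ → ℝ} {l B : ℝ} (hl : |l| ≤ B) (hB : ∀ s, |h s| ≤ B) (d w : ℝ) :
    |ratioInterp h l d w| ≤ B := by
  rw [ratioInterp]
  split_ifs
  exacts [hl, hB _]

theorem continuousAt_ratioInterp {h : ℝ → ℝ} {l : ℝ} (hc : Continuous h)
    (hl : Tendsto h (Bornology.cobounded ℝ) (𝓝 l)) {z : ℝ × ℝ} (hz : z.1 ≠ 0 ∨ z.2 ≠ 0) :
    ContinuousAt (fun z : ℝ × ℝ => ratioInterp h l z.1 z.2) z := by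
  by_cases hd : z.1 = 0
  · have hw : z.2 ≠ 0 := hz.resolve_left (not_not.2 hd)
    have h1 : ContinuousAt (Function.update (fun y => h y⁻¹) 0 l) (z.1 / z.2) := by
      rw [hd, zero_div, continuousAt_update_same]
      exact hl.comp tendsto_inv₀_nhdsNE_zero
    have h2 : ContinuousAt (fun z : ℝ × ℝ => z.1 / z.2) z :=
      continuousAt_fst.div continuousAt_snd hw
    refine (ContinuousAt.comp (f := fun z : ℝ × ℝ => z.1 / z.2) h1 h2).congr ?_
    filter_upwards [continuousAt_snd.eventually_ne hw] with y hy
    by_cases hy1 : y.1 = 0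
    · simp [ratioInterp, hy1]
    · have : y.1 / y.2 ≠ 0 := div_ne_zero hy1 hy
      simp [ratioInterp, hy1, hy]
  · have h2 : ContinuousAt (fun z : ℝ × ℝ => z.2 / z.1) z :=
      continuousAt_snd.div continuousAt_fst hd
    refine (ContinuousAt.comp (f := fun z : ℝ × ℝ => z.2 / z.1) hc.continuousAt h2).congr ?_
    filter_upwards [continuousAt_fst.eventually_ne hd] with y hy
    simp [ratioInterp, hy]

theorem continuous_ratioInterp_mul_phip {X : Type*} [TopologicalSpace X] {p : ℝ} (hp : 1 < p)
    {h : ℝ → ℝ} {l : ℝ} (hc : Continuous h) (hl : Tendsto h (Bornology.cobounded ℝ) (𝓝 l))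
    {d w S : X → ℝ} (hd : Continuous d) (hw : Continuous w) (hS : Continuous S)
    (h0 : ∀ z, d z = 0 → w z = 0 → S z = 0) :
    Continuous fun z => ratioInterp h l (d z) (w z) * phip p (S z) := by
  rw [continuous_iff_continuousAt]
  intro z
  have hφ : Continuous fun z => phip p (S z) := (continuous_phip hp).comp hS
  by_cases hz : d z ≠ 0 ∨ w z ≠ 0
  · have h1 := ContinuousAt.comp (f := fun z => (d z, w z)) (x := z)
      (continuousAt_ratioInterp hc hl (z := (d z, w z)) hz) (hd.prodMk hw).continuousAt
    exact h1.mul hφ.continuousAt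
  · push Not at hz
    have hSz := h0 z hz.1 hz.2
    obtain ⟨B, -, hlB, hB⟩ := exists_abs_le_of_tendsto_cobounded hc hl
    rw [ContinuousAt, hSz, phip_zero, mul_zero]
    refine squeeze_zero_norm (a := fun z => B * |phip p (S z)|) (fun y => ?_) ?_
    · rw [norm_eq_abs, abs_mul]
      gcongr
      exact abs_ratioInterp_le hlB hB _ _
    · have : Continuous fun z => B * |phip p (S z)| := by fun_prop
      simpa [hSz, phip_zero] using this.tendsto z

theorem abs_phip_le_one {p s : ℝ} (hp : 1 < p) (hs : |s| ≤ 1) : |phip p s| ≤ 1 := by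
  rw [abs_phip hp]
  exact rpow_le_one (abs_nonneg _) hs (by linarith)

theorem abs_halfTerm_le {p s : ℝ} (hp : 1 < p) (hs : |s| ≤ 1) (lam a α β : ℝ) :
    |halfTerm p lam a α β s| ≤ |lam| * |a| + |α| + |β| := by
  have h1 := abs_phip_le_one hp hs
  have h2 : |phip p (max s 0)| ≤ 1 := abs_phip_le_one hp <| by
    simpa using (abs_max_sub_max_le_abs s 0 0).trans (by simpa using hs)
  have h3 : |phip p (-min s 0)| ≤ 1 := abs_phip_le_one hp <| by
    rw [abs_neg]
    simpa using (abs_min_sub_min_le_max s 0 0 0).trans (by simpa using hs)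
  have key : ∀ {c x : ℝ}, |x| ≤ 1 → |c * x| ≤ |c| := fun {c x} hx => by
    rw [abs_mul]; exact mul_le_of_le_one_right (abs_nonneg _) hx
  rw [halfTerm, ← abs_mul]
  exact (abs_add_three _ _ _).trans (add_le_add (add_le_add (key h1) (key h2)) (key h3))

/-- The family of vector fields, in polar coordinates, joining the problems linearised at the
origin and at infinity through the rescalings of the nonlinear problem. -/
noncomputable def nodalField (p q r l : ℝ) (h A Al Be : ℝ → ℝ) (s x : ℝ) (y : ℝ × ℝ) : ℝ × ℝ :=
  (angSpeed p q (phip q (cos y.1)) (-halfTerm p (r * ratioInterp h l (1 - s)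
      (s * (exp (y.2 / p) * sin y.1))) (A x) (Al x) (Be x) (sin y.1)) y.1,
    radSpeed p q (phip q (cos y.1)) (-halfTerm p (r * ratioInterp h l (1 - s)
      (s * (exp (y.2 / p) * sin y.1))) (A x) (Al x) (Be x) (sin y.1)) y.1)

theorem continuous_nodalField {p q r l : ℝ} (hp : 1 < p) (hq : 1 < q) {h A Al Be : ℝ → ℝ}
    (hc : Continuous h) (hl : Tendsto h (Bornology.cobounded ℝ) (𝓝 l)) (hA : Continuous A)
    (hAl : Continuous Al) (hBe : Continuous Be) :
    Continuous fun z : ℝ × ℝ × ℝ × ℝ => nodalField p q r l h A Al Be z.1 z.2.1 z.2.2 := by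
  have hp' := continuous_phip hp
  have hq' := continuous_phip hq
  have h1 := continuous_ratioInterp_mul_phip hp hc hl (X := ℝ × ℝ × ℝ × ℝ) (d := fun z => 1 - z.1)
    (w := fun z => z.1 * (exp (z.2.2.2 / p) * sin z.2.2.1)) (S := fun z => sin z.2.2.1)
    (by fun_prop) (by fun_prop) (by fun_prop) (fun z hd hw => by
      rw [← sub_eq_zero.1 hd, one_mul] at hw
      exact (mul_eq_zero.1 hw).resolve_left (exp_pos _).ne')
  have hP : Continuous fun z : ℝ × ℝ × ℝ × ℝ => -halfTerm p (r * ratioInterp h l (1 - z.1)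
      (z.1 * (exp (z.2.2.2 / p) * sin z.2.2.1))) (A z.2.1) (Al z.2.1) (Be z.2.1)
      (sin z.2.2.1) := by
    have h2 : Continuous fun z : ℝ × ℝ × ℝ × ℝ => -(r * A z.2.1 * (ratioInterp h l (1 - z.1)
        (z.1 * (exp (z.2.2.2 / p) * sin z.2.2.1)) * phip p (sin z.2.2.1)) +
        Al z.2.1 * phip p (max (sin z.2.2.1) 0) + Be z.2.1 * phip p (-min (sin z.2.2.1) 0)) := by
      fun_prop
    refine h2.congr fun z => ?_
    rw [halfTerm]
    ring
  have hp0 : 0 < p := by linarith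
  have hq0 : 0 < q := by linarith
  exact (Continuous.angSpeed hp0 hq0 (by fun_prop) hP (by fun_prop)).prodMk
    (Continuous.radSpeed hp0 hq0 (by fun_prop) hP (by fun_prop))

theorem exists_norm_nodalField_le {p q r l : ℝ} (hp : 1 < p) (hq : 1 < q) {h A Al Be : ℝ → ℝ}
    (hc : Continuous h) (hl : Tendsto h (Bornology.cobounded ℝ) (𝓝 l)) {M : ℝ}
    (hA : ∀ x, |A x| ≤ M) (hAl : ∀ x, |Al x| ≤ M) (hBe : ∀ x, |Be x| ≤ M) :
    ∃ B, ∀ s x y, ‖nodalField p q r l h A Al Be s x y‖ ≤ B := by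
  obtain ⟨B, hB0, hlB, hB⟩ := exists_abs_le_of_tendsto_cobounded hc hl
  refine ⟨(p + q) * (1 + (|r| * B * M + M + M)), fun s x y => ?_⟩
  have h1 := abs_phip_le_one hq (abs_cos_le_one y.1)
  have h2 : |-halfTerm p (r * ratioInterp h l (1 - s) (s * (exp (y.2 / p) * sin y.1))) (A x) (Al x)
      (Be x) (sin y.1)| ≤ |r| * B * M + M + M := by
    rw [abs_neg]
    refine (abs_halfTerm_le hp (abs_sin_le_one _) _ _ _ _).trans ?_
    rw [abs_mul]
    gcongr
    exacts [abs_ratioInterp_le hlB hB _ _, hA x, hAl x, hBe x]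
  refine norm_prod_le_iff.2 ⟨?_, ?_⟩
  · exact (abs_angSpeed_le hp hq _ _ _).trans (by gcongr)
  · exact (abs_radSpeed_le hp hq _ _ _).trans (by gcongr)

end Interpolation

section Nodal

open Real

theorem isSolNod_of_nodalField {p q r l f0 s : ℝ} (hpq : p.HolderConjugate q) {a α β f : ℝ → ℝ}
    {A Al Be : ℝ → ℝ} (hA : EqOn A a (Icc 0 1)) (hAl : EqOn Al α (Icc 0 1))
    (hBe : EqOn Be β (Icc 0 1)) (hf : f 0 = 0) (hs : s ∈ Ioo (0 : ℝ) 1) {y : ℝ → ℝ × ℝ}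
    {ω₀ ν : ℝ} {j : ℕ} (hsin : sin ω₀ = 0) (hcos : cos ω₀ = ν)
    (hy : SolvesIVP (nodalField p q r l (phipRatio p f0 f) A Al Be s) (ω₀, 0) y)
    (hy1 : (y 1).1 = ω₀ + j * π) :
    ∃ u : ℝ → ℝ, IsSolNod p r a α β f u ∧
      {x ∈ Ioo (0 : ℝ) 1 | u x = 0}.Finite ∧
      {x ∈ Ioo (0 : ℝ) 1 | u x = 0}.ncard = j - 1 ∧
      ∃ δ > 0, ∀ x ∈ Ioo (0 : ℝ) δ, 0 < ν * u x := by
  have hp := hpq.lt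
  have hq := hpq.symm.lt
  obtain ⟨hyc, hy0, hy⟩ := hy
  have hd : 1 - s ≠ 0 := by linarith [hs.2]
  set t := s / (1 - s) with ht_def
  have ht : 0 < t := div_pos hs.1 (by linarith [hs.2])
  have hν : ν ≠ 0 := by
    rintro rfl
    simpa [hsin, hcos] using sin_sq_add_cos_sq ω₀
  let u : ℝ → ℝ := fun x => t * (exp ((y x).2 / p) * sin (y x).1)
  let P : ℝ → ℝ := fun x =>
    -halfTerm p (r * phipRatio p f0 f (u x)) (a x) (α x) (β x) (sin (y x).1)
  have hfield : ∀ x ∈ Icc (0 : ℝ) 1,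
      nodalField p q r l (phipRatio p f0 f) A Al Be s x (y x) =
        (angSpeed p q (phip q (cos (y x).1)) (P x) (y x).1,
          radSpeed p q (phip q (cos (y x).1)) (P x) (y x).1) := by
    intro x hx
    have hu : s * (exp ((y x).2 / p) * sin (y x).1) / (1 - s) = u x := by
      simp only [u, t]
      ring
    simp only [nodalField, ratioInterp, hd, if_false, hu, hA hx, hAl hx, hBe hx, P]
  have hω : ∀ x ∈ Icc (0 : ℝ) 1, HasDerivAt (fun x => (y x).1)
      (angSpeed p q (phip q (cos (y x).1)) (P x) (y x).1) x := by
    intro x hx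
    have := (hy x hx).comp_fst
    rwa [hfield x hx] at this
  have hσ : ∀ x ∈ Icc (0 : ℝ) 1, HasDerivAt (fun x => (y x).2)
      (radSpeed p q (phip q (cos (y x).1)) (P x) (y x).1) x := by
    intro x hx
    have := (hy x hx).comp_snd
    rwa [hfield x hx] at this
  have hderiv : ∀ x ∈ Icc (0 : ℝ) 1,
      deriv u x = t * (exp ((y x).2 / p) * phip q (cos (y x).1)) := fun x hx =>
    ((hasDerivAt_polar hpq.pos hpq.symm.pos (hω x hx) (hσ x hx)).1.const_mul t).deriv
  have hphip : ∀ x ∈ Icc (0 : ℝ) 1,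
      phip p (deriv u x) = t ^ (p - 1) * (exp ((y x).2 / q) * cos (y x).1) := by
    intro x hx
    rw [hderiv x hx, phip_mul ht, phip_mul (exp_pos _), exp_div_rpow hpq, phip_phip hpq]
  have hcross : CrossesUpward fun x => (y x).1 - ω₀ :=
    crossesUpward_sub (p := p) hq hsin fun x hx => ⟨_, hω x hx⟩
  have hu_sin : ∀ x, ν * u x = t * exp ((y x).2 / p) * sin ((y x).1 - ω₀) := by
    intro x
    rw [sin_sub_of_sin_eq_zero hsin, hcos]
    simp only [u]
    ring
  have hzero : ∀ x, sin ((y x).1 - ω₀) = 0 ↔ u x = 0 := by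
    intro x
    have h1 := hu_sin x
    have h2 : t * exp ((y x).2 / p) ≠ 0 := (mul_pos ht (exp_pos _)).ne'
    constructor <;> intro h
    · rw [h, mul_zero] at h1
      exact (mul_eq_zero.1 h1).resolve_left hν
    · rw [h, mul_zero, eq_comm] at h1
      exact (mul_eq_zero.1 h1).resolve_left h2
  have h00 : (y 0).1 - ω₀ = 0 := by rw [hy0, sub_self]
  have h10 : (y 1).1 - ω₀ = j * π := by rw [hy1, add_sub_cancel_left]
  have hzeros := hcross.zeros h00 h10
  simp only [hzero] at hzeros
  refine ⟨u, ⟨⟨?_, ?_, ?_⟩, fun x hx => ?_⟩, hzeros.1, Nat.eq_sub_of_add_eq hzeros.2, ?_⟩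
  · exact contDiff_const.mul ((hyc.snd.div_const p).exp.mul hyc.fst.sin)
  · rw [← hzero, h00, sin_zero]
  · rw [← hzero, h10, sin_nat_mul_pi]
  · have hx' := Ioo_subset_Icc_self hx
    have h1 := (hasDerivAt_polar hpq.pos hpq.symm.pos (hω x hx') (hσ x hx')).2.const_mul
      (t ^ (p - 1))
    refine (h1.congr_of_eventuallyEq ?_).congr_deriv ?_
    · filter_upwards [Ioo_mem_nhds hx.1 hx.2] with z hz
      exact hphip z (Ioo_subset_Icc_self hz)
    · have h2 : halfTerm p (r * phipRatio p f0 f (u x)) (a x) (α x) (β x) (u x) =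
          r * a x * f (u x) + α x * phip p (max (u x) 0) + β x * phip p (-min (u x) 0) := by
        rw [halfTerm, ← phipRatio_mul_phip (p := p) (f0 := f0) hf (u x)]
        ring
      rw [← h2]
      simp only [P, mul_neg, neg_inj]
      rw [← exp_div_rpow hpq, ← halfTerm_mul (exp_pos _), ← halfTerm_mul ht]
  · obtain ⟨δ, hδ, h⟩ := hcross.exists_sin_pos h00
    refine ⟨δ, hδ, fun x hx => ?_⟩
    rw [hu_sin]
    exact mul_pos (mul_pos ht (exp_pos _)) (h x hx)

end Nodal

/-- **Corollary 4.1**: existence of multiple nodal solutions. -/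
theorem stmt12 (p : ℝ) (hp : 1 < p)
    (a α β : ℝ → ℝ)
    (ha : ContinuousOn a (Icc 0 1)) (hapos : ∀ x ∈ Icc (0:ℝ) 1, 0 < a x)
    (hα : ContinuousOn α (Icc 0 1)) (hβ : ContinuousOn β (Icc 0 1))
    (f : ℝ → ℝ) (hf : Continuous f)
    -- (A1)
    (hA1 : ∀ s : ℝ, s ≠ 0 → 0 < s * f s)
    -- (A2)
    (f0 finf : ℝ) (hf0pos : 0 < f0) (hfinfpos : 0 < finf)
    (hf0 : Tendsto (fun s => f s / phip p s) (𝓝[≠] (0:ℝ)) (𝓝 f0))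
    (hfinf : Tendsto (fun s => f s / phip p s) (atBot ⊔ atTop) (𝓝 finf))
    (k n : ℕ) (hk : 1 ≤ k) (hkn : k ≤ n) (ν : ℝ) (hν : ν = 1 ∨ ν = -1)
    -- λ_j^ν : the j-th half-eigenvalues, k ≤ j ≤ n
    (lamH : ℕ → ℝ)
    (hlamH : ∀ j : ℕ, k ≤ j → j ≤ n → ∃ u, IsHalfSol p a α β (lamH j) u ∧ MemS j ν u)
    (r : ℝ)
    (hr : (lamH n / finf < r ∧ r < lamH k / f0) ∨ (lamH n / f0 < r ∧ r < lamH k / finf)) :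
    ∀ j : ℕ, k ≤ j → j ≤ n →
      ∃ u : ℝ → ℝ, IsSolNod p r a α β f u ∧
        {x ∈ Ioo (0:ℝ) 1 | u x = 0}.Finite ∧
        {x ∈ Ioo (0:ℝ) 1 | u x = 0}.ncard = j - 1 ∧
        ∃ δ > 0, ∀ x ∈ Ioo (0:ℝ) δ, 0 < ν * u x := by
  intro j hkj hjn
  obtain ⟨q, hpq⟩ : ∃ q, p.HolderConjugate q := ⟨_, Real.HolderConjugate.conjExponent hp⟩
  have hq := hpq.symm.lt
  obtain ⟨ω₀, hsin, hcos⟩ : ∃ ω₀, Real.sin ω₀ = 0 ∧ Real.cos ω₀ = ν := by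
    rcases hν with rfl | rfl
    exacts [⟨0, Real.sin_zero, Real.cos_zero⟩, ⟨Real.pi, Real.sin_pi, Real.cos_pi⟩]
  have hfz : f 0 = 0 := by
    have hsub : closure (Ioi (0 : ℝ)) ⊆ {s | 0 ≤ f s} :=
      closure_minimal (fun s hs => (pos_of_mul_pos_right (hA1 s (ne_of_gt hs)) (le_of_lt hs)).le)
        (isClosed_le continuous_const hf)
    have hsub' : closure (Iio (0 : ℝ)) ⊆ {s | f s ≤ 0} :=
      closure_minimal (fun s hs => by
        have h1 := hA1 s (ne_of_lt hs)
        have h2 : s < 0 := hs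
        by_contra! h3
        have h4 : 0 < f s := not_le.1 h3
        nlinarith) (isClosed_le hf continuous_const)
    refine le_antisymm (hsub' ?_) (hsub ?_)
    · rw [closure_Iio]; exact self_mem_Iic
    · rw [closure_Ioi]; exact self_mem_Ici
  obtain ⟨A, hAc, hA, M₁, hM₁⟩ := exists_continuous_bounded_extension ha
  obtain ⟨Al, hAlc, hAl, M₂, hM₂⟩ := exists_continuous_bounded_extension hα
  obtain ⟨Be, hBec, hBe, M₃, hM₃⟩ := exists_continuous_bounded_extension hβ
  let M := max M₁ (max M₂ M₃)
  have hAM : ∀ x, |A x| ≤ M := fun x => (hM₁ x).trans (le_max_left _ _)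
  have hAlM : ∀ x, |Al x| ≤ M := fun x =>
    (hM₂ x).trans ((le_max_left _ _).trans (le_max_right _ _))
  have hBeM : ∀ x, |Be x| ≤ M := fun x =>
    (hM₃ x).trans ((le_max_right _ _).trans (le_max_right _ _))
  have hc : Continuous (phipRatio p f0 f) := continuous_phipRatio hp hf hf0
  have hl : Tendsto (phipRatio p f0 f) (Bornology.cobounded ℝ) (𝓝 finf) := tendsto_phipRatio hfinf
  have hF := continuous_nodalField (r := r) hp hq hc hl hAc hAlc hBec
  obtain ⟨B, hB⟩ := exists_norm_nodalField_le (r := r) hp hq hc hl hAM hAlM hBeM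
  have hlt := @halfAngle_lt p q hp hq a α β M hapos
    (fun x hx => hA hx ▸ hAM x) (fun x hx => hAl hx ▸ hAlM x) (fun x hx => hBe hx ▸ hBeM x)
  have hangle0 : ∀ y, SolvesIVP (nodalField p q r finf (phipRatio p f0 f) A Al Be 0) (ω₀, 0) y →
      ∀ x ∈ Icc (0 : ℝ) 1, HasDerivAt (fun x => (y x).1)
        (halfAngSpeed p q (r * f0) (a x) (α x) (β x) (y x).1) x := by
    intro y hy x hx
    have h := (hy.2.2 x hx).comp_fst
    simpa [nodalField, halfAngSpeed, ratioInterp, phipRatio_zero, hA hx, hAl hx, hBe hx] using h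
  have hangle1 : ∀ y, SolvesIVP (nodalField p q r finf (phipRatio p f0 f) A Al Be 1) (ω₀, 0) y →
      ∀ x ∈ Icc (0 : ℝ) 1, HasDerivAt (fun x => (y x).1)
        (halfAngSpeed p q (r * finf) (a x) (α x) (β x) (y x).1) x := by
    intro y hy x hx
    have h := (hy.2.2 x hx).comp_fst
    simpa [nodalField, halfAngSpeed, ratioInterp, hA hx, hAl hx, hBe hx] using h
  have hbelow : ∀ lam < lamH k, ∀ ω : ℝ → ℝ, ω 0 = ω₀ →
      (∀ x ∈ Icc (0 : ℝ) 1, HasDerivAt ω (halfAngSpeed p q lam (a x) (α x) (β x) (ω x)) x) →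
      ω 1 < ω₀ + j * Real.pi := by
    intro lam hlam ω hω0 hω
    obtain ⟨u, hu, hS⟩ := hlamH k le_rfl hkn
    obtain ⟨θ, hθ0, hθ1, hθ⟩ := exists_halfAngle hpq ha hα hβ hu hk hS hsin hcos
    refine (hlt hlam hω hθ (hω0.trans hθ0.symm)).trans_le ?_
    rw [hθ1]
    gcongr
  have habove : ∀ lam > lamH n, ∀ ω : ℝ → ℝ, ω 0 = ω₀ →
      (∀ x ∈ Icc (0 : ℝ) 1, HasDerivAt ω (halfAngSpeed p q lam (a x) (α x) (β x) (ω x)) x) →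
      ω₀ + j * Real.pi < ω 1 := by
    intro lam hlam ω hω0 hω
    obtain ⟨u, hu, hS⟩ := hlamH n hkn le_rfl
    obtain ⟨θ, hθ0, hθ1, hθ⟩ := exists_halfAngle hpq ha hα hβ hu (hk.trans hkn) hS hsin hcos
    refine lt_of_le_of_lt ?_ (hlt hlam hθ hω (hθ0.trans hω0.symm))
    rw [hθ1]
    gcongr
  have hshoot : ∃ s ∈ Ioo (0 : ℝ) 1, ∃ y,
      SolvesIVP (nodalField p q r finf (phipRatio p f0 f) A Al Be s) (ω₀, 0) y ∧
        (y 1).1 = ω₀ + j * Real.pi := by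
    rcases hr with ⟨h1, h2⟩ | ⟨h1, h2⟩
    · rw [div_lt_iff₀ hfinfpos] at h1
      rw [lt_div_iff₀ hf0pos] at h2
      exact exists_solvesIVP_eq hF hB (ω₀, 0) (ψ := fun z => z.1) continuous_fst
        (fun y hy => hbelow _ h2 _ (by simp only [hy.2.1]) (hangle0 y hy))
        (fun y hy => habove _ h1 _ (by simp only [hy.2.1]) (hangle1 y hy))
    · rw [div_lt_iff₀ hf0pos] at h1
      rw [lt_div_iff₀ hfinfpos] at h2
      obtain ⟨s, hs, y, hy, hy1⟩ := exists_solvesIVP_eq hF hB (ω₀, 0) (ψ := fun z => -z.1)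
        (c := -(ω₀ + j * Real.pi)) continuous_fst.neg
        (fun y hy => neg_lt_neg (habove _ h1 _ (by simp only [hy.2.1]) (hangle0 y hy)))
        (fun y hy => neg_lt_neg (hbelow _ h2 _ (by simp only [hy.2.1]) (hangle1 y hy)))
      exact ⟨s, hs, y, hy, neg_inj.1 hy1⟩
  obtain ⟨s, hs, y, hy, hy1⟩ := hshoot
  exact isSolNod_of_nodalField hpq hA hAl hBe hfz hs hsin hcos hy hy1
end

section
/- For every ρ ≠ 0, the pair (λ(ρ), u(ρ)) = (1 − sin(1/|ρ|), x ↦ ρ sin x) is a solution of the problem −u'' = λu + u·sin((u² + (u')²)^{−1/2}) on (0,π), u(0) = u(π) = 0. Consequently, every point of [0,2] × {0} is a bifurcation point of this problem: for every λ* ∈ [0,2] there is a sequence of nontrivial solutions (λ_n, u_n) with λ_n → λ* and u_n → 0 in C¹[0,π]. -/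
open Set Filter Topology

/-- a solution of `-u'' = λ u + u sin((u² + u'²)^{-1/2})` on (0,π), `u(0) = u(π) = 0`,
with `u ∈ C²[0,π]`.  (Note that where `u = u' = 0` the nonlinear term
`u·sin(1/√(u² + u'²))` automatically vanishes, matching the convention that it is
interpreted as 0 there.) -/
def IsSolEx (lam : ℝ) (u : ℝ → ℝ) : Prop :=
  ContDiff ℝ 2 u ∧ u 0 = 0 ∧ u Real.pi = 0 ∧
  ∀ x ∈ Ioo 0 Real.pi,
    -(deriv (deriv u) x) =
      lam * u x + u x * Real.sin (1 / Real.sqrt ((u x) ^ 2 + (deriv u x) ^ 2))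

/-- the `C¹` norm on `[0,π]`. -/
noncomputable def normC1pi (u : ℝ → ℝ) : ℝ :=
  (⨆ x : Icc (0:ℝ) Real.pi, |u x|) + (⨆ x : Icc (0:ℝ) Real.pi, |deriv u x|)

theorem deriv_const_mul_sin (ρ : ℝ) :
    deriv (fun x => ρ * Real.sin x) = fun x => ρ * Real.cos x := by
  ext x
  exact ((Real.hasDerivAt_sin x).const_mul ρ).deriv

theorem deriv_const_mul_cos (ρ : ℝ) :
    deriv (fun x => ρ * Real.cos x) = fun x => -(ρ * Real.sin x) := by
  ext x
  simp

theorem isSolEx_const_mul_sin (ρ : ℝ) :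
    IsSolEx (1 - Real.sin (1 / |ρ|)) (fun x => ρ * Real.sin x) := by
  refine ⟨contDiff_const.mul Real.contDiff_sin, by simp, by simp, fun x _ => ?_⟩
  have h : (ρ * Real.sin x) ^ 2 + (ρ * Real.cos x) ^ 2 = ρ ^ 2 := by
    linear_combination ρ ^ 2 * Real.sin_sq_add_cos_sq x
  simp only [deriv_const_mul_sin, deriv_const_mul_cos, h, Real.sqrt_sq_eq_abs]
  ring

theorem normC1pi_nonneg (u : ℝ → ℝ) : 0 ≤ normC1pi u :=
  add_nonneg (Real.iSup_nonneg fun _ => abs_nonneg _) (Real.iSup_nonneg fun _ => abs_nonneg _)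

theorem normC1pi_const_mul_sin_le (ρ : ℝ) :
    normC1pi (fun x => ρ * Real.sin x) ≤ 2 * |ρ| := by
  have : Nonempty (Icc (0 : ℝ) Real.pi) := ⟨⟨0, le_rfl, Real.pi_pos.le⟩⟩
  rw [normC1pi, deriv_const_mul_sin, two_mul]
  refine add_le_add (ciSup_le fun x => ?_) (ciSup_le fun x => ?_) <;> rw [abs_mul]
  · exact mul_le_of_le_one_right (abs_nonneg ρ) (Real.abs_sin_le_one x)
  · exact mul_le_of_le_one_right (abs_nonneg ρ) (Real.abs_cos_le_one x)

theorem exists_seq_pos_tendsto_zero_sin_one_div_eq {s : ℝ} (hs : s ∈ Icc (-1 : ℝ) 1) :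
    ∃ ρ : ℕ → ℝ, (∀ n, 0 < ρ n) ∧ Tendsto ρ atTop (𝓝 0) ∧ ∀ n, Real.sin (1 / ρ n) = s := by
  refine ⟨fun n => (Real.arcsin s + (n + 1 : ℕ) * (2 * Real.pi))⁻¹, fun n => ?_, ?_, fun n => ?_⟩
  · have h := Real.neg_pi_div_two_le_arcsin s
    have hn : (0 : ℝ) ≤ n * (2 * Real.pi) := by positivity
    apply inv_pos.mpr
    push_cast
    linarith [Real.pi_pos]
  · refine tendsto_inv_atTop_zero.comp (tendsto_atTop_add_const_left _ _ ?_)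
    exact (tendsto_natCast_atTop_atTop.comp (tendsto_add_atTop_nat 1)).atTop_mul_const
      Real.two_pi_pos
  · rw [one_div, inv_inv, Real.sin_add_nat_mul_two_pi, Real.sin_arcsin hs.1 hs.2]

/-- **Example 2.1**: `(1 - sin(1/|ρ|), ρ sin x)` solves the problem for every `ρ ≠ 0`;
consequently every point of `[0,2] × {0}` is a bifurcation point. -/
theorem stmt16 :
    (∀ ρ : ℝ, ρ ≠ 0 →
      IsSolEx (1 - Real.sin (1 / |ρ|)) (fun x => ρ * Real.sin x)) ∧
    (∀ lamstar ∈ Icc (0:ℝ) 2,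
      ∃ lamn : ℕ → ℝ, ∃ un : ℕ → ℝ → ℝ,
        (∀ n : ℕ, IsSolEx (lamn n) (un n) ∧ ∃ x ∈ Icc (0:ℝ) Real.pi, un n x ≠ 0) ∧
        Tendsto lamn atTop (𝓝 lamstar) ∧
        Tendsto (fun n => normC1pi (un n)) atTop (𝓝 0)) := by
  refine ⟨fun ρ _ => isSolEx_const_mul_sin ρ, fun l hl => ?_⟩
  obtain ⟨ρ, hpos, hlim, hsin⟩ := exists_seq_pos_tendsto_zero_sin_one_div_eq
    (s := 1 - l) ⟨by linarith [hl.2], by linarith [hl.1]⟩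
  refine ⟨fun _ => l, fun n x => ρ n * Real.sin x, fun n => ⟨?_, Real.pi / 2, ?_, ?_⟩,
    tendsto_const_nhds, ?_⟩
  · simpa [abs_of_pos (hpos n), hsin n, ← one_div] using isSolEx_const_mul_sin (ρ n)
  · constructor <;> linarith [Real.pi_pos]
  · simpa using (hpos n).ne'
  · refine squeeze_zero (fun n => normC1pi_nonneg _) (fun n => normC1pi_const_mul_sin_le _) ?_
    simpa using hlim.abs.const_mul 2
end

section
/- For every ε > 0 there exists J such that for all j ≥ J, every nontrivial C¹ solution u of (φ_p(u'))' + j φ_p(u) = 0 on an interval of length at least ε has a zero in that interval; equivalently, the distance between any two consecutive zeros of any nontrivial solution of (φ_p(u'))' + j φ_p(u) = 0 tends to zero as j → +∞. -/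
open Set Filter Topology

theorem phip_of_pos (p : ℝ) {s : ℝ} (hs : 0 < s) : phip p s = s ^ (p - 1) := by
  rw [phip, abs_of_pos hs, ← Real.rpow_add_one hs.ne']
  congr 1
  ring

theorem phip_strictMono {p : ℝ} (hp : 1 < p) : StrictMono (phip p) := by
  refine strictMono_of_odd_strictMonoOn_nonneg (phip_neg p) ?_
  intro x hx y _ hxy
  have hx : 0 ≤ x := hx
  have hy : 0 < y := hx.trans_lt hxy
  rw [phip_of_pos p hy]
  rcases hx.eq_or_lt with rfl | hx0
  · simpa [phip] using Real.rpow_pos_of_pos hy (p - 1)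
  · rw [phip_of_pos p hx0]
    exact Real.rpow_lt_rpow hx hxy (by linarith)

theorem sub_le_mul_sub_of_hasDerivAt_le {f f' : ℝ → ℝ} {a b C : ℝ} (hab : a ≤ b)
    (hf : ∀ x ∈ Icc a b, HasDerivAt f (f' x) x) (hC : ∀ x ∈ Icc a b, f' x ≤ C) :
    f b - f a ≤ C * (b - a) := by
  refine (convex_Icc a b).image_sub_le_mul_sub_of_deriv_le
    (fun x hx => (hf x hx).continuousAt.continuousWithinAt)
    (fun x hx => (hf x (interior_subset hx)).differentiableAt.differentiableWithinAt)
    (fun x hx => ?_) a (left_mem_Icc.2 hab) b (right_mem_Icc.2 hab) hab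
  rw [(hf x (interior_subset hx)).deriv]
  exact hC x (interior_subset hx)

/-- A solution that is positive on `[a, a + 2h]` and non-increasing at `a` forces `j h^p < 1`. -/
theorem mul_rpow_lt_one_of_pos_of_deriv_nonpos {p j h a : ℝ} {u : ℝ → ℝ} (hp : 1 < p)
    (hh : 0 < h) (hj : 0 < j)
    (hu : ∀ x ∈ Icc a (a + 2 * h), DifferentiableAt ℝ u x)
    (hw : ∀ x ∈ Icc a (a + 2 * h),
      HasDerivAt (fun y => phip p (deriv u y)) (-(j * phip p (u x))) x)
    (hpos : ∀ x ∈ Icc a (a + 2 * h), 0 < u x) (ha : deriv u a ≤ 0) :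
    j * h * h ^ (p - 1) < 1 := by
  have hmono := phip_strictMono hp
  have hphi0 : phip p 0 = 0 := by simp [phip]
  have hanti : ∀ x ∈ Icc a (a + 2 * h), ∀ y ∈ Icc a (a + 2 * h), x ≤ y →
      deriv u y ≤ deriv u x := by
    intro x hx y hy hxy
    have hsub : Icc x y ⊆ Icc a (a + 2 * h) := Icc_subset_Icc hx.1 hy.2
    have := sub_le_mul_sub_of_hasDerivAt_le (C := 0) hxy (fun z hz => hw z (hsub hz))
      (fun z hz => by
        have h1 : 0 < phip p (u z) := hphi0 ▸ hmono (hpos z (hsub hz))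
        have := mul_pos hj h1
        linarith)
    exact hmono.le_iff_le.1 (by linarith)
  have hmem_a : a ∈ Icc a (a + 2 * h) := ⟨le_rfl, by linarith⟩
  have hmem_c : a + h ∈ Icc a (a + 2 * h) := ⟨by linarith, by linarith⟩
  have hmem_b : a + 2 * h ∈ Icc a (a + 2 * h) := ⟨by linarith, le_rfl⟩
  have hdecr : ∀ x ∈ Icc a (a + h), u (a + h) ≤ u x := by
    intro x hx
    have hsub : Icc x (a + h) ⊆ Icc a (a + 2 * h) := Icc_subset_Icc hx.1 (by linarith)
    have := sub_le_mul_sub_of_hasDerivAt_le (C := 0) hx.2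
      (fun z hz => (hu z (hsub hz)).hasDerivAt)
      (fun z hz => (hanti a hmem_a z (hsub hz) (hsub hz).1).trans ha)
    linarith
  have hflux : phip p (deriv u (a + h)) ≤ -(j * phip p (u (a + h)) * h) := by
    have hsub : Icc a (a + h) ⊆ Icc a (a + 2 * h) := Icc_subset_Icc le_rfl (by linarith)
    have := sub_le_mul_sub_of_hasDerivAt_le (C := -(j * phip p (u (a + h))))
      (by linarith : a ≤ a + h) (fun z hz => hw z (hsub hz))
      (fun z hz => neg_le_neg
        (mul_le_mul_of_nonneg_left (hmono.monotone (hdecr z hz)) hj.le))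
    have h0 : phip p (deriv u a) ≤ 0 := hphi0 ▸ hmono.monotone ha
    linarith
  have hslope : u (a + 2 * h) - u (a + h) ≤ deriv u (a + h) * h := by
    have hsub : Icc (a + h) (a + 2 * h) ⊆ Icc a (a + 2 * h) :=
      Icc_subset_Icc (by linarith) le_rfl
    have := sub_le_mul_sub_of_hasDerivAt_le (C := deriv u (a + h))
      (by linarith : a + h ≤ a + 2 * h)
      (fun z hz => (hu z (hsub hz)).hasDerivAt)
      (fun z hz => hanti _ hmem_c z (hsub hz) hz.1)
    linarith
  have hc := hpos _ hmem_c
  have hbound : -deriv u (a + h) < u (a + h) / h := by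
    rw [lt_div_iff₀ hh]
    linarith [hpos _ hmem_b]
  have hlt := hmono hbound
  rw [phip_neg, phip_of_pos p (div_pos hc hh), Real.div_rpow hc.le hh.le,
    lt_div_iff₀ (Real.rpow_pos_of_pos hh _)] at hlt
  rw [phip_of_pos p hc] at hflux
  have hcp := Real.rpow_pos_of_pos hc (p - 1)
  have hhp := Real.rpow_pos_of_pos hh (p - 1)
  refine lt_of_mul_lt_mul_right ?_ hcp.le
  calc j * h * h ^ (p - 1) * u (a + h) ^ (p - 1)
      = j * u (a + h) ^ (p - 1) * h * h ^ (p - 1) := by ring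
    _ ≤ -phip p (deriv u (a + h)) * h ^ (p - 1) :=
        mul_le_mul_of_nonneg_right (by linarith) hhp.le
    _ < 1 * u (a + h) ^ (p - 1) := by linarith

/-- A solution that is positive on `[a - 2h, a + 2h]` forces `j h^p < 1`. -/
theorem mul_rpow_lt_one_of_pos {p j h a : ℝ} {u : ℝ → ℝ} (hp : 1 < p)
    (hh : 0 < h) (hj : 0 < j)
    (hu : ∀ x ∈ Icc (a - 2 * h) (a + 2 * h), DifferentiableAt ℝ u x)
    (hw : ∀ x ∈ Icc (a - 2 * h) (a + 2 * h),
      HasDerivAt (fun y => phip p (deriv u y)) (-(j * phip p (u x))) x)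
    (hpos : ∀ x ∈ Icc (a - 2 * h) (a + 2 * h), 0 < u x) :
    j * h * h ^ (p - 1) < 1 := by
  rcases le_total (deriv u a) 0 with ha | ha
  · have hsub : Icc a (a + 2 * h) ⊆ Icc (a - 2 * h) (a + 2 * h) :=
      Icc_subset_Icc (by linarith) le_rfl
    exact mul_rpow_lt_one_of_pos_of_deriv_nonpos hp hh hj (fun x hx => hu x (hsub hx))
      (fun x hx => hw x (hsub hx)) (fun x hx => hpos x (hsub hx)) ha
  · have hmem : ∀ x ∈ Icc (-a) (-a + 2 * h), -x ∈ Icc (a - 2 * h) (a + 2 * h) :=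
      fun x hx => ⟨by linarith [hx.2], by linarith [hx.1]⟩
    refine mul_rpow_lt_one_of_pos_of_deriv_nonpos (a := -a) (u := fun x => u (-x)) hp hh hj
      (fun x hx => (hu _ (hmem x hx)).comp x differentiableAt_id.neg) (fun x hx => ?_)
      (fun x hx => hpos _ (hmem x hx)) ?_
    · have hderiv := ((hw _ (hmem x hx)).comp x (hasDerivAt_neg x)).neg
      have hfun : (fun y => phip p (deriv (fun x => u (-x)) y)) =
          -((fun y => phip p (deriv u y)) ∘ Neg.neg) := by
        funext y
        simp [deriv_comp_neg, phip_neg]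
      rw [hfun]
      exact hderiv.congr_deriv (by ring)
    · rw [deriv_comp_neg]
      simpa using ha

/-- The distance between consecutive zeros of nontrivial solutions of
`(φ_p(u'))' + j φ_p(u) = 0` tends to 0 as `j → +∞`: for every `ε > 0` there is `J` such
that for all `j ≥ J`, every nontrivial C¹ solution on an interval of length at least `ε`
has a zero in that interval. -/
theorem stmt18 (p : ℝ) (hp : 1 < p) :
    ∀ ε > (0:ℝ), ∃ J : ℝ, ∀ j : ℝ, J ≤ j →
      ∀ σ τ : ℝ, σ + ε ≤ τ →
        ∀ u : ℝ → ℝ,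
          (∀ x ∈ Ioo σ τ, DifferentiableAt ℝ u x) →
          (∀ x ∈ Ioo σ τ,
            HasDerivAt (fun y => phip p (deriv u y)) (-(j * phip p (u x))) x) →
          (∃ x ∈ Ioo σ τ, u x ≠ 0) →
          ∃ x ∈ Ioo σ τ, u x = 0 := by
  intro ε hε
  set h := ε / 8 with hh_def
  have hh : 0 < h := by positivity
  have hK : 0 < h * h ^ (p - 1) := mul_pos hh (Real.rpow_pos_of_pos hh _)
  refine ⟨1 / (h * h ^ (p - 1)), fun j hJ σ τ hστ u hu hw _ => ?_⟩
  have hj : 0 < j := (one_div_pos.2 hK).trans_le hJ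
  rw [div_le_iff₀ hK, ← mul_assoc] at hJ
  by_contra! hne
  have hsub : Icc ((σ + τ) / 2 - 2 * h) ((σ + τ) / 2 + 2 * h) ⊆ Ioo σ τ :=
    fun x hx => ⟨by linarith [hx.1], by linarith [hx.2]⟩
  have hsign : (∀ x ∈ Ioo σ τ, 0 < u x) ∨ ∀ x ∈ Ioo σ τ, u x < 0 := by
    by_contra! hcon
    obtain ⟨⟨x, hx, hux⟩, y, hy, huy⟩ := hcon
    obtain ⟨z, hz, huz⟩ := isPreconnected_Ioo.intermediate_value hx hy
      (fun z hz => (hu z hz).continuousAt.continuousWithinAt) ⟨hux, huy⟩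
    exact hne z hz huz
  refine hJ.not_gt ?_
  rcases hsign with hpos | hneg
  · exact mul_rpow_lt_one_of_pos hp hh hj (fun x hx => hu x (hsub hx))
      (fun x hx => hw x (hsub hx)) (fun x hx => hpos x (hsub hx))
  · refine mul_rpow_lt_one_of_pos (a := (σ + τ) / 2) (u := fun x => -u x) hp hh hj
      (fun x hx => (hu x (hsub hx)).neg)
      (fun x hx => ?_) (fun x hx => neg_pos.2 (hneg x (hsub hx)))
    have hfun : (fun y => phip p (deriv (fun x => -u x) y)) =
        -fun y => phip p (deriv u y) := by
      funext y
      simp [deriv.fun_neg, phip_neg]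
    rw [hfun]
    exact (hw x (hsub hx)).neg.congr_deriv (by simp [phip_neg])
end
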